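/- Fix r ≥ 3, σ ∈ {-1,1}^r with σ₁ = -σ₂, and j₃,…,j_r ∈ ℤ^d; set j_{≥3} := σ₃j₃ + ⋯ + σ_rj_r, and for j₁ ∈ ℤ^d set j₂ := j₁ + σ₁ j_{≥3} and g_{j₁}(a) := Σ_{k=1}^r σ_k √(1 + |j_k|⁴_a). With I := { i : j_{≥3,i} ≠ 0 }, C_i := { j₁ : |j_{1,i}| ≥ 2(1 + Σ_{k=3}^r |j_{k,i}|²) }, S := { j₁ ∈ ℤ^d ∖ ∪_{i∈I} C_i : (σ,j) is non-resonant } and R_γ := { j₁ ∈ S : |j₁| ≥ γ^{-1/2} (⟨j₃⟩⋯⟨j_r⟩)^{2dr²} }, one has: for all γ > 0, the Lebesgue measure of { a ∈ (1,4)^d : ∃ j₁ ∈ R_γ with |g_{j₁}(a)| < γ } is ≲_{r,d} γ^{1/r²} (⟨j₃⟩⋯⟨j_r⟩)^{2d}. -/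

import Mathlib

open MeasureTheory
open scoped BigOperators

noncomputable section

namespace BeamPaper

abbrev Idx (d : ℕ) := Fin d → ℤ
def jnormSq (d : ℕ) (j : Idx d) : ℝ := ∑ i, ((j i : ℝ)) ^ 2
def enorm (d : ℕ) (j : Idx d) : ℝ := Real.sqrt (jnormSq d j)
def jap (d : ℕ) (j : Idx d) : ℝ := Real.sqrt (1 + jnormSq d j)
def anormSq (d : ℕ) (a : Fin d → ℝ) (j : Idx d) : ℝ := ∑ i, a i * (j i : ℝ) ^ 2
def omg (d : ℕ) (a : Fin d → ℝ) (j : Idx d) : ℝ := Real.sqrt (1 + anormSq d a j ^ 2)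
def prodTail (d : ℕ) {r : ℕ} (j : Fin r → Idx d) : ℝ :=
  ∏ i : Fin r, if 2 ≤ (i : ℕ) then jap d (j i) else 1
def box (d : ℕ) : Set (Fin d → ℝ) := Set.univ.pi fun _ => Set.Ioo (1 : ℝ) 4

def IsResonant {d r : ℕ} (σ : Fin r → ℤ) (j : Fin r → Idx d) : Prop :=
  Even r ∧ ∃ ρ : Equiv.Perm (Fin r),
    (∀ i, ρ (ρ i) = i) ∧ (∀ i, ρ i ≠ i) ∧
      ∀ i, (∀ l, |j (ρ i) l| = |j i l|) ∧ σ (ρ i) = - σ i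

/-- The non-resonance property of the parameter `a` established in Proposition 2.2
(`mainNR`) of the paper: lower bounds on the small divisors `Σ σ_k ω_{j_k}`,
outside resonant couples. -/
def GoodParam (d : ℕ) (a : Fin d → ℝ) : Prop :=
  ∃ γ : ℝ, 0 < γ ∧ ∃ c : ℕ → ℝ, ∃ C : ℕ → ℝ → ℝ,
    (∀ r, 0 < c r) ∧ (∀ r δ, 0 < C r δ) ∧
      ∀ (r : ℕ) (_hr : 3 ≤ r) (δ : ℝ), 0 < δ →
        ∀ (σ : Fin r → ℤ) (j : Fin r → Idx d),
          (∀ i, σ i = 1 ∨ σ i = -1) →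
          (∑ i, σ i • j i) = 0 →
          (∀ i i' : Fin r, i ≤ i' → enorm d (j i') ≤ enorm d (j i)) →
          ¬ IsResonant σ j →
          (σ ⟨0, by omega⟩ * σ ⟨1, by omega⟩ = 1 →
            c r * (γ * prodTail d j ^ (-(9 * (d : ℝ) * (r : ℝ) ^ 2))) ≤
              |∑ k, (σ k : ℝ) * omg d a (j k)|) ∧
          (σ ⟨0, by omega⟩ * σ ⟨1, by omega⟩ = -1 →
            C r δ * (γ * jap d (j ⟨0, by omega⟩) ^ (-((d : ℝ) - 1 + δ)) *
              prodTail d j ^ (-(44 * (d : ℝ) * (r : ℝ) ^ 4))) ≤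
              |∑ k, (σ k : ℝ) * omg d a (j k)|)

/-- `j_{≥3} = σ₃ j₃ + ⋯ + σ_r j_r` (0-based: indices `k ≥ 2`). -/
def jge3 (d r : ℕ) (σ : Fin r → ℤ) (jt : Fin r → Idx d) : Idx d :=
  fun l => ∑ k : Fin r, if 2 ≤ (k : ℕ) then σ k * jt k l else 0

/-- `j₂ := j₁ + σ₁ j_{≥3}`. -/
def j2of (d r : ℕ) (hr : 3 ≤ r) (σ : Fin r → ℤ) (jt : Fin r → Idx d) (j1 : Idx d) : Idx d :=
  fun l => j1 l + σ ⟨0, by omega⟩ * jge3 d r σ jt l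

/-- The family `(j₁, j₂, j₃, …, j_r)`. -/
def Jfam (d r : ℕ) (hr : 3 ≤ r) (σ : Fin r → ℤ) (jt : Fin r → Idx d) (j1 : Idx d) :
    Fin r → Idx d :=
  fun k => if (k : ℕ) = 0 then j1 else if (k : ℕ) = 1 then j2of d r hr σ jt j1 else jt k

/-- `g_{j₁}(a) = Σ_k σ_k √(1+|j_k|_a⁴)`. -/
def gfun (d r : ℕ) (hr : 3 ≤ r) (σ : Fin r → ℤ) (jt : Fin r → Idx d) (j1 : Idx d)
    (a : Fin d → ℝ) : ℝ :=
  ∑ k, (σ k : ℝ) * omg d a (Jfam d r hr σ jt j1 k)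

/-- `⟨j₃⟩⋯⟨j_r⟩` in terms of the tail data. -/
def tailProd (d r : ℕ) (jt : Fin r → Idx d) : ℝ :=
  ∏ k : Fin r, if 2 ≤ (k : ℕ) then jap d (jt k) else 1

/-- `j₁ ∈ S`: `j₁ ∉ ⋃_{i ∈ I} C_i` and `(σ,j)` is non-resonant. -/
def memS (d r : ℕ) (hr : 3 ≤ r) (σ : Fin r → ℤ) (jt : Fin r → Idx d) (j1 : Idx d) : Prop :=
  (∀ i : Fin d, jge3 d r σ jt i ≠ 0 →
      ¬ (2 * (1 + ∑ k : Fin r, if 2 ≤ (k : ℕ) then (jt k i) ^ 2 else 0) ≤ |j1 i|)) ∧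
  ¬ IsResonant σ (Jfam d r hr σ jt j1)

/-- `j₁ ∈ R_γ`: `j₁ ∈ S` and `|j₁| ≥ γ^{-1/2} (⟨j₃⟩⋯⟨j_r⟩)^{2dr²}`. -/
def memR (d r : ℕ) (hr : 3 ≤ r) (σ : Fin r → ℤ) (jt : Fin r → Idx d) (γ : ℝ)
    (j1 : Idx d) : Prop :=
  memS d r hr σ jt j1 ∧
    γ ^ (-(1 : ℝ) / 2) * tailProd d r jt ^ (2 * d * r ^ 2 : ℕ) ≤ enorm d j1

/-- One step of the elimination: `G ↦ ((s + z) G' - α G) / α` turns the coefficient `c k` of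
`(s + y k) ^ α` into `c k * (z - y k)` and lowers the exponent by one. By the mean value theorem
it is controlled at some point between two points where `G` is small. -/
lemma exists_abs_sum_mul_sub_rpow_le {ι : Type*} (A : Finset ι) (y c : ι → ℝ)
    (hy : ∀ k ∈ A, 0 ≤ y k) {α z s₁ s₂ h ε : ℝ} {R : ℕ} (hα : α ≤ -(1 / 2)) (hαR : -α ≤ R)
    (hz : 0 ≤ z) (hs₁ : s₁ ∈ Set.Icc (1 / 4 : ℝ) 1) (hs₂ : s₂ ∈ Set.Icc (1 / 4 : ℝ) 1)
    (hh : 0 < h) (hs : s₁ + h ≤ s₂)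
    (h₁ : |∑ k ∈ A, c k * (s₁ + y k) ^ α| ≤ ε) (h₂ : |∑ k ∈ A, c k * (s₂ + y k) ^ α| ≤ ε) :
    ∃ ξ ∈ Set.Ioo s₁ s₂, |∑ k ∈ A, c k * (z - y k) * (ξ + y k) ^ (α - 1)| ≤
      ε * (4 ^ (R + 1) * (1 + z)) / h := by
  set G : ℝ → ℝ := fun s => ∑ k ∈ A, c k * (s + y k) ^ α with hG
  have hε : 0 ≤ ε := (abs_nonneg _).trans h₁
  have hlt : s₁ < s₂ := by linarith
  have hderivG : ∀ s, 1 / 4 ≤ s →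
      HasDerivAt G (∑ k ∈ A, c k * (α * (s + y k) ^ (α - 1))) s := by
    intro s hs'
    apply HasDerivAt.fun_sum
    intro k hk
    have hpos : s + y k ≠ 0 := by have := hy k hk; linarith
    have := (((hasDerivAt_id s).add_const (y k)).rpow_const (p := α) (Or.inl hpos)).const_mul (c k)
    simpa using this
  have hderiv : ∀ s, 1 / 4 ≤ s → HasDerivAt (fun s => (s + z) ^ (-α) * G s)
      ((s + z) ^ (-α - 1) * (α * ∑ k ∈ A, c k * (z - y k) * (s + y k) ^ (α - 1))) s := by
    intro s hs'
    have hpos : 0 < s + z := by linarith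
    have h1 := ((hasDerivAt_id s).add_const z).rpow_const (p := -α) (Or.inl hpos.ne')
    have := h1.mul (hderivG s hs')
    refine this.congr_deriv ?_
    have e1 : (s + z) ^ (-α) = (s + z) ^ (-α - 1) * (s + z) := by
      rw [← Real.rpow_add_one hpos.ne']; congr 1; ring
    simp only [id, hG]
    rw [e1]
    have e2 : ∀ k ∈ A, c k * (s + y k) ^ α = c k * ((s + y k) ^ (α - 1) * (s + y k)) := by
      intro k hk
      have hpos : s + y k ≠ 0 := by have := hy k hk; linarith
      rw [← Real.rpow_add_one hpos]; congr 2; ring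
    rw [Finset.sum_congr rfl e2]
    have : 1 * -α * (s + z) ^ (-α - 1) * ∑ k ∈ A, c k * ((s + y k) ^ (α - 1) * (s + y k)) +
        (s + z) ^ (-α - 1) * (s + z) * ∑ k ∈ A, c k * (α * (s + y k) ^ (α - 1)) =
      (s + z) ^ (-α - 1) * (α * (-(∑ k ∈ A, c k * ((s + y k) ^ (α - 1) * (s + y k))) +
        (s + z) * ∑ k ∈ A, c k * (s + y k) ^ (α - 1))) := by
      have : ∑ k ∈ A, c k * (α * (s + y k) ^ (α - 1)) =
          α * ∑ k ∈ A, c k * (s + y k) ^ (α - 1) := by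
        rw [Finset.mul_sum]; exact Finset.sum_congr rfl fun _ _ => by ring
      rw [this]; ring
    rw [this]
    congr 2
    rw [Finset.mul_sum, ← Finset.sum_neg_distrib, ← Finset.sum_add_distrib]
    exact Finset.sum_congr rfl fun _ _ => by ring
  obtain ⟨ξ, hξ, heq⟩ := exists_hasDerivAt_eq_slope (fun s => (s + z) ^ (-α) * G s)
    (fun s => (s + z) ^ (-α - 1) * (α * ∑ k ∈ A, c k * (z - y k) * (s + y k) ^ (α - 1))) hlt
    (fun s hs' => (hderiv s (hs₁.1.trans hs'.1)).continuousAt.continuousWithinAt)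
    (fun s hs' => hderiv s (hs₁.1.trans hs'.1.le))
  refine ⟨ξ, hξ, ?_⟩
  set S := ∑ k ∈ A, c k * (z - y k) * (ξ + y k) ^ (α - 1) with hS
  have hξ4 : 1 / 4 ≤ ξ := hs₁.1.trans hξ.1.le
  have hξ1 : ξ ≤ 1 := hξ.2.le.trans hs₂.2
  have hξz : 0 < ξ + z := by linarith
  have hend : ∀ s ∈ Set.Icc (1 / 4 : ℝ) 1, |G s| ≤ ε →
      |(s + z) ^ (-α) * G s| ≤ 4 ^ R * (ξ + z) ^ (-α) * ε := by
    intro s hs' hGs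
    have hsz : 0 < s + z := by linarith [hs'.1]
    rw [abs_mul, abs_of_pos (Real.rpow_pos_of_pos hsz _)]
    refine mul_le_mul ?_ hGs (abs_nonneg _) (by positivity)
    calc (s + z) ^ (-α) ≤ (4 * (ξ + z)) ^ (-α) :=
          Real.rpow_le_rpow hsz.le (by linarith [hs'.2]) (by linarith)
      _ = 4 ^ (-α) * (ξ + z) ^ (-α) := Real.mul_rpow (by norm_num) hξz.le
      _ ≤ 4 ^ R * (ξ + z) ^ (-α) := by
          gcongr
          rw [← Real.rpow_natCast]
          exact Real.rpow_le_rpow_of_exponent_le (by norm_num) hαR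
  have hb1 := hend s₁ hs₁ h₁
  have hb2 := hend s₂ hs₂ h₂
  have habs : |(ξ + z) ^ (-α - 1) * (α * S)| ≤ 2 * (4 ^ R * (ξ + z) ^ (-α) * ε) / h := by
    rw [heq, abs_div, abs_of_pos (sub_pos.2 hlt)]
    refine div_le_div₀ (by positivity) ?_ hh (by linarith)
    exact (abs_sub _ _).trans (by linarith)
  have e1 : (ξ + z) ^ (-α) = (ξ + z) ^ (-α - 1) * (ξ + z) := by
    rw [← Real.rpow_add_one hξz.ne']; congr 1; ring
  have hw : 0 < (ξ + z) ^ (-α - 1) := Real.rpow_pos_of_pos hξz _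
  rw [abs_mul, abs_of_pos hw, abs_mul, e1] at habs
  have h3 : |α| * |S| ≤ 2 * (4 ^ R * (ξ + z) * ε) / h := by
    refine le_of_mul_le_mul_left (habs.trans (le_of_eq ?_)) hw
    ring
  have h4 : (1 / 2 : ℝ) ≤ |α| := by rw [abs_of_nonpos (by linarith)]; linarith
  have h5 : 1 / 2 * |S| ≤ 2 * (4 ^ R * (1 + z) * ε) / h := by
    refine (mul_le_mul_of_nonneg_right h4 (abs_nonneg _)).trans (h3.trans ?_)
    gcongr
  calc |S| = 2 * (1 / 2 * |S|) := by ring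
    _ ≤ 2 * (2 * (4 ^ R * (1 + z) * ε) / h) := by linarith
    _ = ε * (4 ^ (R + 1) * (1 + z)) / h := by ring

/-- Elimination of the nodes `zs`, one after the other. -/
lemma exists_abs_sum_mul_prod_sub_rpow_le {ι : Type*} (A : Finset ι) (y : ι → ℝ)
    (hy : ∀ k ∈ A, 0 ≤ y k) {h : ℝ} (hh : 0 < h) (R : ℕ) (zs : List ℝ) :
    ∀ (_ : ∀ z ∈ zs, 0 ≤ z) (n : ℕ) (_ : n + zs.length + 1 ≤ R) (c : ι → ℝ) (ε : ℝ) (p : ℕ → ℝ)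
      (_ : ∀ i < 2 ^ zs.length, p i ∈ Set.Icc (1 / 4 : ℝ) 1)
      (_ : ∀ i, i + 1 < 2 ^ zs.length → p i + h ≤ p (i + 1))
      (_ : ∀ i < 2 ^ zs.length, |∑ k ∈ A, c k * (p i + y k) ^ (-(1 / 2) - n : ℝ)| ≤ ε),
      ∃ s ∈ Set.Icc (1 / 4 : ℝ) 1,
        |∑ k ∈ A, c k * (zs.map fun z => z - y k).prod *
          (s + y k) ^ (-(1 / 2) - n - zs.length : ℝ)| ≤
        ε * (zs.map fun z => 4 ^ (R + 1) * (1 + z)).prod / h ^ zs.length := by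
  induction zs with
  | nil =>
    intro _ n _ c ε p hp _ hG
    refine ⟨p 0, hp 0 (by simp), ?_⟩
    simpa using hG 0 (by simp)
  | cons z zs ih =>
    intro hz n hn c ε p hp hsep hG
    simp only [List.length_cons] at *
    have hstep : ∀ i : ℕ, ∃ ξ : ℝ, i < 2 ^ zs.length → ξ ∈ Set.Ioo (p (2 * i)) (p (2 * i + 1)) ∧
        |∑ k ∈ A, c k * (z - y k) * (ξ + y k) ^ (-(1 / 2) - n - 1 : ℝ)| ≤
          ε * (4 ^ (R + 1) * (1 + z)) / h := by
      intro i
      by_cases hi : i < 2 ^ zs.length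
      · have h1 : 2 * i + 1 < 2 ^ (zs.length + 1) := by rw [pow_succ]; omega
        obtain ⟨ξ, hξ, hb⟩ := exists_abs_sum_mul_sub_rpow_le A y c hy
          (α := -(1 / 2) - n) (z := z) (R := R) (ε := ε)
          (by have : (0 : ℝ) ≤ n := n.cast_nonneg
              linarith)
          (by have : (n : ℝ) + 1 ≤ R := by exact_mod_cast (by omega : n + 1 ≤ R)
              linarith)
          (hz z (by simp)) (hp (2 * i) (by omega)) (hp (2 * i + 1) h1) hh (hsep _ h1)
          (hG _ (by omega)) (hG _ h1)
        exact ⟨ξ, fun _ => ⟨hξ, hb⟩⟩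
      · exact ⟨0, fun h' => absurd h' hi⟩
    choose q hq using hstep
    obtain ⟨s, hs, hb⟩ := ih (fun w hw => hz w (by simp [hw])) (n + 1) (by omega)
      (fun k => c k * (z - y k)) (ε * (4 ^ (R + 1) * (1 + z)) / h) q
      (fun i hi => by
        have h1 : 2 * i + 1 < 2 ^ (zs.length + 1) := by rw [pow_succ]; omega
        exact ⟨(hp (2 * i) (by omega)).1.trans (hq i hi).1.1.le,
          (hq i hi).1.2.le.trans (hp _ h1).2⟩)
      (fun i hi => by
        have h1 : 2 * i + 1 + 1 < 2 ^ (zs.length + 1) := by rw [pow_succ]; omega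
        have h2 := (hq i (by omega)).1.2
        have h3 := (hq (i + 1) hi).1.1
        have h4 := hsep _ h1
        have h5 : 2 * (i + 1) = 2 * i + 1 + 1 := by ring
        rw [h5] at h3
        linarith)
      (fun i hi => by
        have := (hq i hi).2
        push_cast
        rwa [show (-(1 / 2) - (n + 1) : ℝ) = -(1 / 2) - n - 1 by ring])
    refine ⟨s, hs, ?_⟩
    simp only [List.map_cons, List.prod_cons]
    convert hb using 1
    · congr 1
      refine Finset.sum_congr rfl fun k _ => ?_
      push_cast
      rw [mul_assoc (c k) (z - y k)]
      congr 2
      ring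
    · rw [pow_succ]
      field_simp
      ring

/-- A set of reals without long `h`-separated sequences has small measure. -/
lemma volume_le_of_no_separated {h : ℝ} (hh : 0 < h) (n : ℕ) :
    ∀ (Λ : Set ℝ), BddBelow Λ →
      (¬ ∃ p : ℕ → ℝ, (∀ i < n + 1, p i ∈ Λ) ∧ ∀ i, i + 1 < n + 1 → p i + h ≤ p (i + 1)) →
      volume Λ ≤ ENNReal.ofReal (n * (2 * h)) := by
  induction n with
  | zero =>
    intro Λ _ hno
    have : Λ = ∅ := by
      by_contra hne
      obtain ⟨x, hx⟩ := Set.nonempty_iff_ne_empty.2 hne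
      exact hno ⟨fun _ => x, fun _ _ => hx, fun i hi => by omega⟩
    simp [this]
  | succ n ih =>
    intro Λ hbdd hno
    rcases Λ.eq_empty_or_nonempty with rfl | hne
    · simp
    obtain ⟨q, hq, hqlt⟩ := exists_lt_of_csInf_lt hne (lt_add_of_pos_right (sInf Λ) hh)
    have hsub : Λ ⊆ Set.Icc (sInf Λ) (sInf Λ + 2 * h) ∪ (Λ ∩ Set.Ici (q + h)) := by
      intro x hx
      by_cases hxq : q + h ≤ x
      · exact Or.inr ⟨hx, hxq⟩
      · exact Or.inl ⟨csInf_le hbdd hx, by linarith⟩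
    have hrec := ih (Λ ∩ Set.Ici (q + h)) (hbdd.mono Set.inter_subset_left) (by
      rintro ⟨p, hp, hsep⟩
      refine hno ⟨fun i => if i = 0 then q else p (i - 1), ?_, ?_⟩
      · intro i hi
        rcases i with _ | i
        · simpa using hq
        · simpa using (hp i (by omega)).1
      · intro i hi
        rcases i with _ | i
        · simpa using (hp 0 (by omega)).2
        · simpa using hsep i (by omega))
    calc volume Λ ≤ volume (Set.Icc (sInf Λ) (sInf Λ + 2 * h)) + volume (Λ ∩ Set.Ici (q + h)) :=
          (measure_mono hsub).trans (measure_union_le _ _)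
      _ ≤ ENNReal.ofReal (2 * h) + ENNReal.ofReal (n * (2 * h)) := by
          gcongr
          rw [Real.volume_Icc]
          simp
      _ = ENNReal.ofReal ((n + 1 : ℕ) * (2 * h)) := by
          rw [← ENNReal.ofReal_add (by positivity) (by positivity)]
          congr 1; push_cast; ring

/-- A combination of square roots that is small at `2 ^ (#B + 1)` points separated by `h`: the
functions `t ↦ √(1 + (t x k) ^ 2)` with `k ∈ B` and the linear term are eliminated. -/
lemma pow_mul_prod_abs_sub_le_of_separated {ι : Type*} [DecidableEq ι] {A B : Finset ι}
    (hBA : B ⊆ A)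
    (x c : ι → ℝ) (x₀ w₀ L : ℝ) (hx : ∀ k ∈ A \ B, x k = x₀) (hc : 1 ≤ |∑ k ∈ A \ B, c k|)
    (hw₀ : 0 < w₀) (hxw : 1 + x₀ ^ 2 ≤ w₀ ^ 2) {R : ℕ} (hR : B.card + 1 ≤ R) {h ε : ℝ}
    (hh : 0 < h) (p : ℕ → ℝ) (hp : ∀ i < 2 ^ (B.card + 1), p i ∈ Set.Icc (1 : ℝ) 2)
    (hsep : ∀ i, i + 1 < 2 ^ (B.card + 1) → p i + h ≤ p (i + 1))
    (hf : ∀ i < 2 ^ (B.card + 1), |L * p i + ∑ k ∈ A, c k * √(1 + (p i * x k) ^ 2)| ≤ ε) :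
    h ^ (B.card + 1) * ∏ k ∈ B, |x k ^ 2 - x₀ ^ 2| ≤
      32 * ε * 8 ^ B.card * (∏ k ∈ B, 4 ^ (R + 1) * (1 + x k ^ 2)) * w₀ ^ (2 * B.card + 1) := by
  set q := B.card with hq
  set y : ι → ℝ := fun k => x k ^ 2 with hy
  have hy0 : ∀ k, 0 ≤ y k := fun k => sq_nonneg _
  set N := 2 ^ (q + 1) with hN
  have hN2 : N = 2 * 2 ^ q := by rw [hN, pow_succ]; ring
  set F : ℝ → ℝ := fun s => L + ∑ k ∈ A, c k * √(s + y k) with hF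
  set s : ℕ → ℝ := fun i => 1 / p (N - 1 - i) ^ 2 with hs
  have hs_mem : ∀ i < N, s i ∈ Set.Icc (1 / 4 : ℝ) 1 := by
    intro i hi
    have h1 := hp (N - 1 - i) (by omega)
    have h2 : 0 < p (N - 1 - i) := by linarith [h1.1]
    constructor
    · exact one_div_le_one_div_of_le (by positivity) (by nlinarith [h1.1, h1.2])
    · rw [hs]
      simp only
      rw [div_le_one (by positivity)]
      nlinarith [h1.1]
  have hs_sep : ∀ i, i + 1 < N → s i + h / 8 ≤ s (i + 1) := by
    intro i hi
    obtain ⟨u1, u2⟩ := hp (N - 1 - (i + 1)) (by omega)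
    obtain ⟨v1, v2⟩ := hp (N - 1 - i) (by omega)
    have h3 := hsep (N - 1 - (i + 1)) (by omega)
    rw [show N - 1 - (i + 1) + 1 = N - 1 - i by omega] at h3
    simp only [hs]
    set u := p (N - 1 - (i + 1))
    set v := p (N - 1 - i)
    have hu0 : 0 < u := by linarith
    have hv0 : 0 < v := by linarith
    have e : 1 / u ^ 2 - 1 / v ^ 2 = (v - u) * ((v + u) / (u ^ 2 * v ^ 2)) := by
      field_simp; ring
    have h4 : 1 / 8 ≤ (v + u) / (u ^ 2 * v ^ 2) := by
      rw [div_le_div_iff₀ (by norm_num) (by positivity)]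
      have hu2 : u ^ 2 ≤ 4 := by nlinarith
      have hv2 : v ^ 2 ≤ 4 := by nlinarith
      have : u ^ 2 * v ^ 2 ≤ 4 * 4 := by gcongr
      linarith
    have h5 : h * (1 / 8) ≤ (v - u) * ((v + u) / (u ^ 2 * v ^ 2)) := by
      gcongr <;> linarith
    linarith
  have hFs : ∀ i < N, |F (s i)| ≤ ε := by
    intro i hi
    have h1 := hp (N - 1 - i) (by omega)
    have h2 := hf (N - 1 - i) (by omega)
    have h0 : 0 < p (N - 1 - i) := by linarith [h1.1]
    simp only [hF, hs]
    set t := p (N - 1 - i)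
    have e : L * t + ∑ k ∈ A, c k * √(1 + (t * x k) ^ 2) =
        t * (L + ∑ k ∈ A, c k * √(1 / t ^ 2 + y k)) := by
      rw [mul_add, Finset.mul_sum, mul_comm L]
      congr 1
      refine Finset.sum_congr rfl fun k _ => ?_
      have : 1 + (t * x k) ^ 2 = t ^ 2 * (1 / t ^ 2 + y k) := by
        simp only [hy]; field_simp
      rw [this, Real.sqrt_mul (by positivity), Real.sqrt_sq h0.le]
      ring
    rw [e, abs_mul, abs_of_pos h0] at h2
    refine le_trans ?_ h2
    exact le_mul_of_one_le_left (abs_nonneg _) h1.1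
  have hFderiv : ∀ ξ, 1 / 4 ≤ ξ →
      HasDerivAt F (1 / 2 * ∑ k ∈ A, c k * (ξ + y k) ^ (-(1 / 2) : ℝ)) ξ := by
    intro ξ hξ
    rw [Finset.mul_sum]
    refine HasDerivAt.const_add _ (HasDerivAt.fun_sum fun k _ => ?_)
    have hpos : 0 < ξ + y k := by linarith [hy0 k]
    have := (((hasDerivAt_id ξ).add_const (y k)).sqrt hpos.ne').const_mul (c k)
    refine this.congr_deriv ?_
    rw [Real.rpow_neg hpos.le, ← Real.sqrt_eq_rpow]
    simp only [id]
    ring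
  have hstep : ∀ i : ℕ, ∃ ξ : ℝ, i < 2 ^ q → ξ ∈ Set.Ioo (s (2 * i)) (s (2 * i + 1)) ∧
      |∑ k ∈ A, c k * (ξ + y k) ^ (-(1 / 2) : ℝ)| ≤ 32 * ε / h := by
    intro i
    by_cases hi : i < 2 ^ q
    · have hlt : s (2 * i) + h / 8 ≤ s (2 * i + 1) := hs_sep _ (by omega)
      have hlt' : s (2 * i) < s (2 * i + 1) := by linarith
      have h14 := (hs_mem (2 * i) (by omega)).1
      obtain ⟨ξ, hξ, heq⟩ := exists_hasDerivAt_eq_slope F _ hlt'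
        (fun u hu => (hFderiv u (h14.trans hu.1)).continuousAt.continuousWithinAt)
        (fun u hu => hFderiv u (h14.trans hu.1.le))
      refine ⟨ξ, fun _ => ⟨hξ, ?_⟩⟩
      have h1 : |(F (s (2 * i + 1)) - F (s (2 * i))) / (s (2 * i + 1) - s (2 * i))| ≤
          2 * ε / (h / 8) := by
        rw [abs_div, abs_of_pos (sub_pos.2 hlt')]
        have a1 := hFs (2 * i) (by omega)
        have a2 := hFs (2 * i + 1) (by omega)
        refine div_le_div₀ (by linarith [abs_nonneg (F (s (2 * i)))]) ?_ (by positivity)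
          (by linarith)
        exact (abs_sub _ _).trans (by linarith)
      rw [← heq, abs_mul, abs_of_pos (by norm_num : (0 : ℝ) < 1 / 2)] at h1
      calc _ ≤ 2 * (2 * ε / (h / 8)) := by linarith
        _ = 32 * ε / h := by field_simp; ring
    · exact ⟨0, fun h' => absurd h' hi⟩
  choose ξ hξ using hstep
  have hlen : (B.toList.map y).length = q := by simp [hq]
  obtain ⟨u, hu, hb⟩ := exists_abs_sum_mul_prod_sub_rpow_le A y (fun k _ => hy0 k)
    (by positivity : 0 < h / 8) R (B.toList.map y)
    (by
      intro z hz
      obtain ⟨k, -, rfl⟩ := List.mem_map.1 hz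
      exact hy0 k)
    0 (by rw [hlen]; omega) c (32 * ε / h) ξ
    (by
      rw [hlen]
      intro i hi
      exact ⟨(hs_mem (2 * i) (by omega)).1.trans (hξ i hi).1.1.le,
        (hξ i hi).1.2.le.trans (hs_mem (2 * i + 1) (by omega)).2⟩)
    (by
      rw [hlen]
      intro i hi
      have h2 := (hξ i (by omega)).1.2
      have h3 := (hξ (i + 1) hi).1.1
      have h4 := hs_sep (2 * i + 1) (by omega)
      rw [show 2 * (i + 1) = 2 * i + 1 + 1 by ring] at h3
      linarith)
    (by
      rw [hlen]
      intro i hi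
      simpa using (hξ i hi).2)
  rw [hlen] at hb
  simp only [List.map_map, Finset.prod_map_toList, Function.comp_def, CharP.cast_eq_zero,
    sub_zero] at hb
  have hu0 : 0 < u + x₀ ^ 2 := by linarith [hu.1, sq_nonneg x₀]
  have hsum : ∑ k ∈ A, c k * (∏ l ∈ B, (y l - y k)) * (u + y k) ^ (-(1 / 2) - q : ℝ) =
      (∑ k ∈ A \ B, c k) * ((∏ l ∈ B, (y l - x₀ ^ 2)) * (u + x₀ ^ 2) ^ (-(1 / 2) - q : ℝ)) := by
    rw [← Finset.sum_sdiff hBA, Finset.sum_mul]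
    have hz : ∑ k ∈ B, c k * (∏ l ∈ B, (y l - y k)) * (u + y k) ^ (-(1 / 2) - q : ℝ) = 0 := by
      refine Finset.sum_eq_zero fun k hk => ?_
      rw [Finset.prod_eq_zero hk (sub_self _)]
      ring
    rw [hz, add_zero]
    refine Finset.sum_congr rfl fun k hk => ?_
    have : y k = x₀ ^ 2 := by simp only [hy, hx k hk]
    rw [this, mul_assoc]
  rw [hsum, abs_mul, abs_mul, Finset.abs_prod] at hb
  have hrp : 1 ≤ |(u + x₀ ^ 2) ^ (-(1 / 2) - q : ℝ)| * w₀ ^ (2 * q + 1) := by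
    rw [abs_of_pos (Real.rpow_pos_of_pos hu0 _)]
    have e : w₀ ^ (2 * q + 1) = (w₀ ^ 2) ^ (1 / 2 + q : ℝ) := by
      rw [← Real.rpow_natCast w₀ 2, ← Real.rpow_mul hw₀.le, ← Real.rpow_natCast]
      congr 1
      push_cast; ring
    rw [e, show (-(1 / 2) - q : ℝ) = -(1 / 2 + q) by ring, Real.rpow_neg hu0.le,
      ← div_eq_inv_mul, one_le_div (Real.rpow_pos_of_pos hu0 _)]
    exact Real.rpow_le_rpow hu0.le (by linarith [hu.2]) (by positivity)
  set P := ∏ k ∈ B, |y k - x₀ ^ 2| with hP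
  have hP0 : 0 ≤ P := Finset.prod_nonneg fun _ _ => abs_nonneg _
  set Q := ∏ k ∈ B, 4 ^ (R + 1) * (1 + y k) with hQ
  have hb2 : P * |(u + x₀ ^ 2) ^ (-(1 / 2) - q : ℝ)| ≤ 32 * ε / h * Q / (h / 8) ^ q :=
    (le_mul_of_one_le_left (by positivity) hc).trans hb
  calc h ^ (q + 1) * P ≤
        h ^ (q + 1) * (P * (|(u + x₀ ^ 2) ^ (-(1 / 2) - q : ℝ)| * w₀ ^ (2 * q + 1))) := by
        gcongr
        exact le_mul_of_one_le_right hP0 hrp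
    _ = h ^ (q + 1) * (P * |(u + x₀ ^ 2) ^ (-(1 / 2) - q : ℝ)|) * w₀ ^ (2 * q + 1) := by ring
    _ ≤ h ^ (q + 1) * (32 * ε / h * Q / (h / 8) ^ q) * w₀ ^ (2 * q + 1) := by gcongr
    _ = 32 * ε * 8 ^ q * Q * w₀ ^ (2 * q + 1) := by
        rw [div_pow, pow_succ]
        field_simp

/-- Measure of a one-dimensional sublevel set of a combination of square roots. -/
lemma volume_sublevel_section_le {ι : Type*} [DecidableEq ι] {A B : Finset ι} (hBA : B ⊆ A)
    (x c J : ι → ℝ) (x₀ J₀ L T τ : ℝ) (hx : ∀ k ∈ A \ B, x k = x₀)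
    (hc : 1 ≤ |∑ k ∈ A \ B, c k|) (hJ : ∀ k, 1 ≤ J k) (hJ₀ : 1 ≤ J₀)
    (hxJ : ∀ k ∈ B, 1 + x k ^ 2 ≤ 16 * J k ^ 4) (hxJ₀ : 1 + x₀ ^ 2 ≤ 16 * J₀ ^ 4)
    (hT : J₀ * ∏ k ∈ B, J k ≤ T) (hτ : 0 < τ) (hτ1 : τ ≤ 1)
    (hgap : ∀ k ∈ B, τ / 4 ≤ |x k ^ 2 - x₀ ^ 2|) {R m : ℕ} (hR : B.card + 1 ≤ R)
    (hm : 3 * B.card + 1 ≤ m) :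
    volume {t : ℝ | t ∈ Set.Icc (1 : ℝ) 2 ∧
      |L * t + ∑ k ∈ A, c k * √(1 + (t * x k) ^ 2)| < 3 * τ ^ m} ≤
      ENNReal.ofReal (2 ^ (R + 1) * (8192 * 4 ^ (R + 1) + 1) * τ * T ^ 2) := by
  set Λ := {t : ℝ | t ∈ Set.Icc (1 : ℝ) 2 ∧
      |L * t + ∑ k ∈ A, c k * √(1 + (t * x k) ^ 2)| < 3 * τ ^ m} with hΛ
  set q := B.card with hq
  set D : ℝ := 8192 * 4 ^ (R + 1) with hD
  have hD1 : 1 ≤ D := by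
    have : (1 : ℝ) ≤ 4 ^ (R + 1) := one_le_pow₀ (by norm_num)
    linarith
  set P := ∏ k ∈ B, J k with hP
  have hP1 : 1 ≤ P := Finset.prod_induction _ (1 ≤ ·)
    (fun _ _ => one_le_mul_of_one_le_of_one_le) le_rfl fun k _ => hJ k
  have hT1 : 1 ≤ T := (one_le_mul_of_one_le_of_one_le hJ₀ hP1).trans hT
  have h2R : (1 : ℝ) ≤ 2 ^ (R + 1) := one_le_pow₀ (by norm_num)
  by_cases hbig : 1 ≤ τ * T ^ 2
  · have h1 : volume Λ ≤ volume (Set.Icc (1 : ℝ) 2) := measure_mono fun t ht => ht.1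
    refine h1.trans ?_
    rw [Real.volume_Icc]
    refine ENNReal.ofReal_le_ofReal ?_
    have : 1 ≤ 2 ^ (R + 1) * (D + 1) := one_le_mul_of_one_le_of_one_le h2R (by linarith)
    nlinarith
  push Not at hbig
  set h := (D + 1) * (τ * T ^ 2) with hh
  have hh0 : 0 < h := by positivity
  have hno : ¬ ∃ p : ℕ → ℝ, (∀ i < (2 ^ (q + 1) - 1) + 1, p i ∈ Λ) ∧
      ∀ i, i + 1 < (2 ^ (q + 1) - 1) + 1 → p i + h ≤ p (i + 1) := by
    rw [Nat.sub_add_cancel Nat.one_le_two_pow]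
    rintro ⟨p, hpΛ, hsep⟩
    have key := pow_mul_prod_abs_sub_le_of_separated hBA x c x₀ (4 * J₀ ^ 2) L hx hc
      (by positivity) (by linarith [hxJ₀]) hR hh0 p (fun i hi => (hpΛ i hi).1) hsep
      (fun i hi => (hpΛ i hi).2.le)
    rw [← hq] at key
    have hlow : (τ / 4) ^ q ≤ ∏ k ∈ B, |x k ^ 2 - x₀ ^ 2| := by
      rw [hq, ← Finset.prod_const]
      exact Finset.prod_le_prod (fun _ _ => by positivity) hgap
    have hup : ∏ k ∈ B, 4 ^ (R + 1) * (1 + x k ^ 2) ≤ (4 ^ (R + 1) * 16) ^ q * P ^ 4 := by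
      rw [hq, ← Finset.prod_const, hP, ← Finset.prod_pow, ← Finset.prod_mul_distrib]
      refine Finset.prod_le_prod (fun _ _ => by positivity) fun k hk => ?_
      rw [mul_assoc]
      exact mul_le_mul_of_nonneg_left (hxJ k hk) (by positivity)
    have hP4 : P ^ 4 ≤ P ^ (4 * q + 2) := by
      rcases Nat.eq_zero_or_pos q with h0 | h0
      · have : B = ∅ := Finset.card_eq_zero.1 (hq ▸ h0)
        simp [hP, this]
      · exact pow_le_pow_right₀ hP1 (by omega)
    have hPJ : P ^ 4 * J₀ ^ (4 * q + 2) ≤ T ^ (4 * q + 2) :=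
      calc P ^ 4 * J₀ ^ (4 * q + 2) ≤ P ^ (4 * q + 2) * J₀ ^ (4 * q + 2) := by gcongr
        _ = (J₀ * P) ^ (4 * q + 2) := by rw [mul_pow, mul_comm]
        _ ≤ T ^ (4 * q + 2) := by gcongr
    have hchain : h ^ (q + 1) * (τ / 4) ^ q ≤
        384 * (2048 * 4 ^ (R + 1)) ^ q * (τ ^ m * T ^ (4 * q + 2)) :=
      calc h ^ (q + 1) * (τ / 4) ^ q ≤ h ^ (q + 1) * ∏ k ∈ B, |x k ^ 2 - x₀ ^ 2| := by gcongr
        _ ≤ _ := key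
        _ ≤ 32 * (3 * τ ^ m) * 8 ^ q * ((4 ^ (R + 1) * 16) ^ q * P ^ 4) *
            (4 * J₀ ^ 2) ^ (2 * q + 1) := by gcongr
        _ = 384 * (2048 * 4 ^ (R + 1)) ^ q * (τ ^ m * (P ^ 4 * J₀ ^ (4 * q + 2))) := by
            have e1 : (4 * J₀ ^ 2) ^ (2 * q + 1) = 4 * 16 ^ q * J₀ ^ (4 * q + 2) := by
              rw [mul_pow, ← pow_mul, pow_succ, pow_mul]
              norm_num
              ring
            have e2 : (2048 * 4 ^ (R + 1) : ℝ) ^ q = 8 ^ q * (4 ^ (R + 1) * 16) ^ q * 16 ^ q := by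
              rw [← mul_pow, ← mul_pow]
              congr 1
              ring
            rw [e1, e2]; ring
        _ ≤ _ := by gcongr
    have hτm : τ ^ m * T ^ (4 * q + 2) ≤ τ ^ (2 * q + 1) * T ^ (2 * q + 2) :=
      calc τ ^ m * T ^ (4 * q + 2) ≤ τ ^ (3 * q + 1) * T ^ (4 * q + 2) := by
            gcongr ?_ * _
            exact pow_le_pow_of_le_one hτ.le hτ1 hm
        _ = (τ ^ (2 * q + 1) * T ^ (2 * q + 2)) * (τ * T ^ 2) ^ q := by
            rw [mul_pow, ← pow_mul]; ring
        _ ≤ (τ ^ (2 * q + 1) * T ^ (2 * q + 2)) * 1 := by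
            gcongr
            exact pow_le_one₀ (by positivity) hbig.le
        _ = _ := mul_one _
    have hfin : (D + 1) ^ (q + 1) * (τ ^ (2 * q + 1) * T ^ (2 * q + 2)) ≤
        D ^ (q + 1) * (τ ^ (2 * q + 1) * T ^ (2 * q + 2)) :=
      calc (D + 1) ^ (q + 1) * (τ ^ (2 * q + 1) * T ^ (2 * q + 2)) =
            4 ^ q * (h ^ (q + 1) * (τ / 4) ^ q) := by
            rw [hh, div_pow, mul_pow, mul_pow, ← pow_mul]
            field_simp
            ring
        _ ≤ 4 ^ q * (384 * (2048 * 4 ^ (R + 1)) ^ q *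
            (τ ^ (2 * q + 1) * T ^ (2 * q + 2))) := by
            refine mul_le_mul_of_nonneg_left (hchain.trans ?_) (by positivity)
            exact mul_le_mul_of_nonneg_left hτm (by positivity)
        _ = 384 * D ^ q * (τ ^ (2 * q + 1) * T ^ (2 * q + 2)) := by
            have : D ^ q = 4 ^ q * (2048 * 4 ^ (R + 1)) ^ q := by
              rw [← mul_pow, hD]; congr 1; ring
            rw [this]; ring
        _ ≤ D ^ (q + 1) * (τ ^ (2 * q + 1) * T ^ (2 * q + 2)) := by
            rw [pow_succ' D]
            gcongr
            have : (1 : ℝ) ≤ 4 ^ (R + 1) := one_le_pow₀ (by norm_num)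
            linarith
    have hlt : D ^ (q + 1) < (D + 1) ^ (q + 1) := by gcongr; linarith
    exact absurd (le_of_mul_le_mul_right hfin (by positivity)) (not_le.2 hlt)
  refine (volume_le_of_no_separated hh0 _ Λ ⟨1, fun t ht => ht.1.1⟩ hno).trans ?_
  refine ENNReal.ofReal_le_ofReal ?_
  have h1 : ((2 ^ (q + 1) - 1 : ℕ) : ℝ) ≤ 2 ^ R := by
    have : 2 ^ (q + 1) ≤ 2 ^ R := Nat.pow_le_pow_right (by norm_num) hR
    exact_mod_cast (Nat.sub_le _ _).trans this
  calc ((2 ^ (q + 1) - 1 : ℕ) : ℝ) * (2 * h) ≤ 2 ^ R * (2 * h) := by gcongr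
    _ = _ := by rw [hh]; ring

/-- A Fubini averaging principle: the measure of `E` is controlled by the measure of its sections
along the curves `t ↦ T (t, a)`, `t ∈ [u, u + 1]`. -/
lemma mul_volume_le_of_curves {d : ℕ} {T : ℝ × (Fin d → ℝ) → Fin d → ℝ} (hT : Measurable T)
    {E K : Set (Fin d → ℝ)} (hE : MeasurableSet E) (u : ℝ) (b m : ENNReal)
    (hb : ∀ t ∈ Set.Icc u (u + 1), b * volume E ≤ volume ((fun a => T (t, a)) ⁻¹' E))
    (hK : ∀ t ∈ Set.Icc u (u + 1), ∀ a, T (t, a) ∈ E → a ∈ K)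
    (hm : ∀ a ∈ K, volume {t | t ∈ Set.Icc u (u + 1) ∧ T (t, a) ∈ E} ≤ m) :
    b * volume E ≤ m * volume K := by
  set J := Set.Icc u (u + 1) with hJ
  have hJm : MeasurableSet J := measurableSet_Icc
  have hJ1 : volume J = 1 := by simp [hJ]
  have hTE : MeasurableSet (T ⁻¹' E) := hT hE
  have h1 : ((volume.restrict J).prod volume) (T ⁻¹' E) =
      ∫⁻ t in J, volume ((fun a => T (t, a)) ⁻¹' E) := by
    rw [Measure.prod_apply hTE]; rfl
  have h2 : ((volume.restrict J).prod volume) (T ⁻¹' E) =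
      ∫⁻ a, volume {t | t ∈ J ∧ T (t, a) ∈ E} := by
    rw [Measure.prod_apply_symm hTE]
    refine lintegral_congr fun a => ?_
    rw [Measure.restrict_apply (hTE.preimage (by fun_prop))]
    congr 1
    ext t
    simp [and_comm]
  calc b * volume E = ∫⁻ _ in J, b * volume E := by simp [hJ1]
    _ ≤ ∫⁻ t in J, volume ((fun a => T (t, a)) ⁻¹' E) := setLIntegral_mono' hJm hb
    _ = ∫⁻ a, volume {t | t ∈ J ∧ T (t, a) ∈ E} := by rw [← h1, h2]
    _ ≤ ∫⁻ a, K.indicator (fun _ => m) a := by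
        refine lintegral_mono fun a => ?_
        by_cases ha : a ∈ K
        · simpa [ha] using hm a ha
        · have : {t | t ∈ J ∧ T (t, a) ∈ E} = ∅ := by
            ext t
            simp only [Set.mem_ofPred_eq, Set.mem_empty_iff_false, iff_false]
            exact fun h => ha (hK t h.1 a h.2)
          simp [this]
    _ ≤ m * volume K := lintegral_indicator_const_le _ _

lemma measurableSet_box (d : ℕ) : MeasurableSet (box d) :=
  MeasurableSet.univ_pi fun _ => measurableSet_Ioo

lemma volume_pi_Ioo_zero_four (d : ℕ) :
    volume (Set.univ.pi fun _ : Fin d => Set.Ioo (0 : ℝ) 4) = ENNReal.ofReal (4 ^ d) := by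
  rw [volume_pi_pi]
  simp [ENNReal.ofReal_pow]

lemma volume_box_le (d : ℕ) : volume (box d) ≤ ENNReal.ofReal (4 ^ d) := by
  rw [← volume_pi_Ioo_zero_four]
  exact measure_mono (Set.pi_mono fun _ _ => Set.Ioo_subset_Ioo_left zero_le_one)

/-- A slab orthogonal to a vector with a coordinate of size at least one. -/
lemma volume_slab_le {d : ℕ} (v : Fin d → ℝ) (i : Fin d) (hv : 1 ≤ |v i|) (ε : ℝ) (hε : 0 ≤ ε) :
    volume {a | a ∈ box d ∧ |∑ l, a l * v l| < ε} ≤ ENNReal.ofReal (4 ^ d * (2 * ε)) := by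
  set E := {a : Fin d → ℝ | a ∈ box d ∧ |∑ l, a l * v l| < ε}
  have hE : MeasurableSet E :=
    (measurableSet_box d).inter
      (measurableSet_lt (by fun_prop : Measurable fun a : Fin d → ℝ => |∑ l, a l * v l|)
        measurable_const)
  have key := mul_volume_le_of_curves (T := fun q => q.2 + q.1 • Pi.single i (1 : ℝ))
    (K := Set.univ.pi fun _ : Fin d => Set.Ioo (0 : ℝ) 4) (by fun_prop) hE 0 1
    (ENNReal.ofReal (2 * ε))
    (fun t _ => by
      rw [one_mul]
      exact (measure_preimage_add_right volume (t • Pi.single i (1 : ℝ)) E).ge)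
    (fun t ht a ha => by
      intro l _
      have h1 := ha.1 l trivial
      simp only [Pi.add_apply, Pi.smul_apply, smul_eq_mul] at h1
      by_cases hl : l = i
      · subst hl
        simp at h1 ht
        exact ⟨by linarith, by linarith⟩
      · simp [hl] at h1
        exact ⟨by linarith, h1.2⟩)
    (fun a _ => by
      have hvi : 0 < |v i| := by linarith
      have hvi0 : v i ≠ 0 := abs_pos.1 hvi
      set w := ∑ l, a l * v l
      have hsub : {t | t ∈ Set.Icc (0 : ℝ) (0 + 1) ∧ a + t • Pi.single i (1 : ℝ) ∈ E} ⊆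
          Set.Icc (-w / v i - ε) (-w / v i + ε) := by
        rintro t ⟨-, -, ht⟩
        have e : ∑ l, (a + t • Pi.single i (1 : ℝ) : Fin d → ℝ) l * v l = w + t * v i := by
          simp [add_mul, Finset.sum_add_distrib, Pi.single_apply, w]
        rw [e] at ht
        have e2 : w + t * v i = (t - -w / v i) * v i := by field_simp; ring
        rw [e2, abs_mul] at ht
        have : |t - -w / v i| ≤ ε := by
          nlinarith [abs_nonneg (t - -w / v i)]
        rw [abs_le] at this
        exact ⟨by linarith, by linarith⟩
      refine (measure_mono hsub).trans ?_
      rw [Real.volume_Icc]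
      refine ENNReal.ofReal_le_ofReal ?_
      linarith)
  rw [one_mul, volume_pi_Ioo_zero_four, ← ENNReal.ofReal_mul (by positivity)] at key
  exact key.trans (le_of_eq (by rw [mul_comm]))

/-- Averaging over dilations. -/
lemma volume_le_of_dilations {d : ℕ} {E : Set (Fin d → ℝ)} (hE : MeasurableSet E)
    (hbox : E ⊆ box d) {m : ℝ} (hm0 : 0 ≤ m)
    (hm : ∀ a : Fin d → ℝ, volume {t : ℝ | t ∈ Set.Icc (1 : ℝ) 2 ∧ t • a ∈ E} ≤ ENNReal.ofReal m) :
    volume E ≤ ENNReal.ofReal (8 ^ d * m) := by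
  have key := mul_volume_le_of_curves (T := fun q => q.1 • q.2)
    (K := Set.univ.pi fun _ : Fin d => Set.Ioo (0 : ℝ) 4) (by fun_prop) hE 1
    (ENNReal.ofReal ((2 ^ d)⁻¹)) (ENNReal.ofReal m)
    (fun t ht => by
      have ht0 : 0 < t := by linarith [ht.1]
      rw [Measure.addHaar_preimage_smul volume ht0.ne']
      gcongr
      rw [abs_of_pos (by positivity), Module.finrank_fin_fun]
      gcongr
      linarith [ht.2])
    (fun t ht a ha => by
      intro l _
      have h1 := hbox ha l trivial
      simp only [Pi.smul_apply, smul_eq_mul] at h1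
      have ht0 : 0 < t := by linarith [ht.1]
      have ha0 : 0 < a l := by
        by_contra hcon
        nlinarith [h1.1]
      exact ⟨ha0, by nlinarith [h1.2, ht.1]⟩)
    (fun a _ => by
      have := hm a
      norm_num at this ⊢
      exact this)
  rw [volume_pi_Ioo_zero_four, ← ENNReal.ofReal_mul hm0] at key
  calc volume E = ENNReal.ofReal (2 ^ d) * (ENNReal.ofReal ((2 ^ d)⁻¹) * volume E) := by
        rw [← mul_assoc, ← ENNReal.ofReal_mul (by positivity), mul_inv_cancel₀ (by positivity)]
        simp
    _ ≤ ENNReal.ofReal (2 ^ d) * ENNReal.ofReal (m * 4 ^ d) := by gcongr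
    _ = ENNReal.ofReal (8 ^ d * m) := by
        rw [← ENNReal.ofReal_mul (by positivity)]
        congr 1
        rw [show (8 : ℝ) = 2 * 4 by norm_num, mul_pow]
        ring

/-- A sign-reversing involution preserving the classes of `f`, when the signs cancel on each
class. -/
lemma exists_involution_of_sum_eq_zero {ι β : Type*} [Fintype ι] [DecidableEq β]
    (σ : ι → ℤ) (hσ : ∀ i, σ i = 1 ∨ σ i = -1) (f : ι → β)
    (h : ∀ b, ∑ i with f i = b, σ i = 0) :
    ∃ ρ : Equiv.Perm ι, (∀ i, ρ (ρ i) = i) ∧ ∀ i, f (ρ i) = f i ∧ σ (ρ i) = -σ i := by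
  classical
  have hcard : ∀ b, Fintype.card {x : {i // σ i = 1} // f x = b} =
      Fintype.card {x : {i // ¬ σ i = 1} // f x = b} := by
    intro b
    have h1 : Fintype.card {x : {i // σ i = 1} // f x = b} =
        (Finset.univ.filter fun i => f i = b ∧ σ i = 1).card := by
      rw [← Fintype.card_subtype]
      refine Fintype.card_congr ((Equiv.subtypeSubtypeEquivSubtypeInter _ (f · = b)).trans
        (Equiv.subtypeEquivRight fun x => and_comm))
    have h2 : Fintype.card {x : {i // ¬ σ i = 1} // f x = b} =
        (Finset.univ.filter fun i => f i = b ∧ ¬ σ i = 1).card := by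
      rw [← Fintype.card_subtype]
      refine Fintype.card_congr ((Equiv.subtypeSubtypeEquivSubtypeInter _ (f · = b)).trans
        (Equiv.subtypeEquivRight fun x => and_comm))
    rw [h1, h2]
    have h3 := h b
    rw [← Finset.sum_filter_add_sum_filter_not _ (fun i => σ i = 1), Finset.filter_filter,
      Finset.filter_filter,
      Finset.sum_congr rfl (g := fun _ => (1 : ℤ)) (fun i hi => (Finset.mem_filter.1 hi).2.2),
      Finset.sum_congr (s₁ := Finset.univ.filter fun i => f i = b ∧ ¬ σ i = 1) rfl
        (g := fun _ => (-1 : ℤ))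
        (fun i hi => (hσ i).resolve_left (Finset.mem_filter.1 hi).2.2)] at h3
    simp only [Finset.sum_const, nsmul_eq_mul, mul_one, mul_neg] at h3
    omega
  let e : {i // σ i = 1} ≃ {i // ¬ σ i = 1} :=
    (Equiv.sigmaFiberEquiv fun x : {i // σ i = 1} => f x).symm.trans
      ((Equiv.sigmaCongrRight fun b => Fintype.equivOfCardEq (hcard b)).trans
        (Equiv.sigmaFiberEquiv fun x : {i // ¬ σ i = 1} => f x))
  have he : ∀ x, f (e x) = f x := fun x =>
    (Fintype.equivOfCardEq (hcard (f x)) ⟨x, rfl⟩).2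
  let g : ι → ι := fun i => if hi : σ i = 1 then e ⟨i, hi⟩ else e.symm ⟨i, hi⟩
  have hg1 : ∀ i (hi : σ i = 1), g i = e ⟨i, hi⟩ := fun i hi => dif_pos hi
  have hg2 : ∀ i (hi : ¬ σ i = 1), g i = e.symm ⟨i, hi⟩ := fun i hi => dif_neg hi
  have hgg : Function.Involutive g := by
    intro i
    by_cases hi : σ i = 1
    · rw [hg1 i hi, hg2 _ (e ⟨i, hi⟩).2]; simp
    · rw [hg2 i hi, hg1 _ (e.symm ⟨i, hi⟩).2]; simp
  refine ⟨hgg.toPerm g, hgg, fun i => ?_⟩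
  change f (g i) = f i ∧ σ (g i) = -σ i
  by_cases hi : σ i = 1
  · rw [hg1 i hi]
    exact ⟨he _, by rw [(hσ _).resolve_left (e ⟨i, hi⟩).2, hi]⟩
  · rw [hg2 i hi]
    refine ⟨?_, by rw [(e.symm ⟨i, hi⟩).2, (hσ i).resolve_left hi]; rfl⟩
    have := he (e.symm ⟨i, hi⟩)
    simpa using this.symm
lemma one_le_jap (d : ℕ) (j : Idx d) : 1 ≤ jap d j := by
  have : 0 ≤ jnormSq d j := Finset.sum_nonneg fun _ _ => sq_nonneg _
  exact Real.one_le_sqrt.2 (by linarith)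

lemma jap_sq (d : ℕ) (j : Idx d) : jap d j ^ 2 = 1 + jnormSq d j := by
  have : 0 ≤ jnormSq d j := Finset.sum_nonneg fun _ _ => sq_nonneg _
  exact Real.sq_sqrt (by linarith)

/-- The indices `k ≥ 2` of the tail. -/
def tail (r : ℕ) : Finset (Fin r) := Finset.univ.filter fun k => 2 ≤ (k : ℕ)

lemma mem_tail {r : ℕ} {k : Fin r} : k ∈ tail r ↔ 2 ≤ (k : ℕ) := by simp [tail]

lemma tailProd_eq (d r : ℕ) (jt : Fin r → Idx d) :
    tailProd d r jt = ∏ k ∈ tail r, jap d (jt k) :=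
  (Finset.prod_filter _ _).symm

lemma one_le_prod_jap {ι : Type*} (s : Finset ι) {d : ℕ} (j : ι → Idx d) :
    1 ≤ ∏ k ∈ s, jap d (j k) :=
  Finset.prod_induction _ (1 ≤ ·) (fun _ _ => one_le_mul_of_one_le_of_one_le) le_rfl
    fun _ _ => one_le_jap _ _

lemma one_le_tailProd (d r : ℕ) (jt : Fin r → Idx d) : 1 ≤ tailProd d r jt := by
  rw [tailProd_eq]
  exact one_le_prod_jap _ _

lemma one_add_sum_sq_le_tailProd_sq {d r : ℕ} (jt : Fin r → Idx d) (i : Fin d) :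
    1 + ∑ k ∈ tail r, (jt k i : ℝ) ^ 2 ≤ tailProd d r jt ^ 2 := by
  rw [tailProd_eq, ← Finset.prod_pow]
  refine le_trans ?_ (Finset.prod_le_prod (f := fun k => 1 + (jt k i : ℝ) ^ 2)
    (fun _ _ => by positivity) fun k _ => ?_)
  · induction tail r using Finset.induction_on with
    | empty => simp
    | insert k s hk ih =>
      rw [Finset.sum_insert hk, Finset.prod_insert hk]
      have h0 : 0 ≤ ∑ k ∈ s, (jt k i : ℝ) ^ 2 := Finset.sum_nonneg fun _ _ => sq_nonneg _
      nlinarith [mul_nonneg (sq_nonneg (jt k i : ℝ)) h0,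
        mul_le_mul_of_nonneg_left ih (by positivity : 0 ≤ 1 + (jt k i : ℝ) ^ 2)]
  · rw [jap_sq]
    gcongr
    exact Finset.single_le_sum (f := fun l => (jt k l : ℝ) ^ 2) (fun _ _ => sq_nonneg _)
      (Finset.mem_univ i)

lemma anormSq_smul {d : ℕ} (t : ℝ) (a : Fin d → ℝ) (j : Idx d) :
    anormSq d (t • a) j = t * anormSq d a j := by
  simp [anormSq, Finset.mul_sum, mul_assoc]

lemma anormSq_congr {d : ℕ} (a : Fin d → ℝ) {j j' : Idx d} (h : ∀ l, |j l| = |j' l|) :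
    anormSq d a j = anormSq d a j' := by
  refine Finset.sum_congr rfl fun l _ => ?_
  have : (j l) ^ 2 = (j' l) ^ 2 := sq_eq_sq_iff_abs_eq_abs _ _ |>.2 (h l)
  congr 1
  exact_mod_cast this

lemma omg_congr {d : ℕ} (a : Fin d → ℝ) {j j' : Idx d} (h : ∀ l, |j l| = |j' l|) :
    omg d a j = omg d a j' := by
  rw [omg, omg, anormSq_congr a h]

/-- Measure of the sublevel set when some class of the tail carries a nonzero coefficient. -/
lemma volume_sublevel_le_of_class_ne_zero {d r : ℕ} (hr : 3 ≤ r) (σ : Fin r → ℤ)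
    (jt : Fin r → Idx d) (κ : Fin d → ℝ) (k₀ : Fin r) (hk₀ : k₀ ∈ tail r)
    (hσ : ∑ k ∈ tail r with ∀ l, |jt k l| = |jt k₀ l|, σ k ≠ 0)
    {τ : ℝ} (hτ : 0 < τ) (hτ1 : τ ≤ 1) :
    volume {a | a ∈ box d ∧ |∑ i, a i * κ i +
      ∑ k ∈ tail r, (σ k : ℝ) * omg d a (jt k)| < 3 * τ ^ (r ^ 2)} ≤
    ENNReal.ofReal ((8 ^ d * (2 ^ (r + 1) * (8192 * 4 ^ (r + 1) + 1)) + r * (4 ^ d * 2)) *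
      τ * tailProd d r jt ^ 2) := by
  classical
  set A := tail r with hA
  set B := A.filter fun k => ¬ ∀ l, |jt k l| = |jt k₀ l| with hB
  set E := {a | a ∈ box d ∧ |∑ i, a i * κ i +
      ∑ k ∈ A, (σ k : ℝ) * omg d a (jt k)| < 3 * τ ^ (r ^ 2)} with hE
  set v : Fin r → Fin d → ℝ := fun k l => (jt k l : ℝ) ^ 2 - (jt k₀ l : ℝ) ^ 2 with hv
  set slab : Fin r → Set (Fin d → ℝ) := fun k => {a | a ∈ box d ∧ |∑ l, a l * v k l| < τ}
    with hslab
  set T := tailProd d r jt with hT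
  have hT1 : 1 ≤ T := one_le_tailProd d r jt
  have hBA : B ⊆ A := Finset.filter_subset _ _
  have hk₀B : k₀ ∉ B := by simp [hB]
  have hAB : A \ B = A.filter fun k => ∀ l, |jt k l| = |jt k₀ l| := by
    ext k
    simp only [hB, Finset.mem_sdiff, Finset.mem_filter]
    tauto
  have hBcard : B.card + 1 ≤ r := by
    have h1 : (insert k₀ B).card ≤ (Finset.univ : Finset (Fin r)).card :=
      Finset.card_le_card (Finset.subset_univ _)
    rwa [Finset.card_insert_of_notMem hk₀B, Finset.card_univ, Fintype.card_fin] at h1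
  have hdiff : ∀ k ∈ B, ∃ l, |jt k l| ≠ |jt k₀ l| := by
    intro k hk
    simpa using (Finset.mem_filter.1 hk).2
  have hslab_le : ∀ k ∈ B, volume (slab k) ≤ ENNReal.ofReal (4 ^ d * (2 * τ)) := by
    intro k hk
    obtain ⟨l, hl⟩ := hdiff k hk
    refine volume_slab_le (v k) l ?_ τ hτ.le
    have h1 : (jt k l) ^ 2 - (jt k₀ l) ^ 2 ≠ 0 := fun h0 =>
      hl (sq_eq_sq_iff_abs_eq_abs _ _ |>.1 (sub_eq_zero.1 h0))
    simp only [hv]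
    exact_mod_cast Int.one_le_abs h1
  have hmeas_slab : ∀ k, MeasurableSet (slab k) := fun k =>
    (measurableSet_box d).inter (measurableSet_lt
      (by fun_prop : Measurable fun a : Fin d → ℝ => |∑ l, a l * v k l|) measurable_const)
  have hmeas_E : MeasurableSet E := by
    refine (measurableSet_box d).inter (measurableSet_lt
      (f := fun a : Fin d → ℝ => |∑ i, a i * κ i + ∑ k ∈ A, (σ k : ℝ) * omg d a (jt k)|)
      (Continuous.measurable ?_) measurable_const)
    unfold omg anormSq
    fun_prop
  set E' := E \ ⋃ k ∈ B, slab k with hE'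
  have hmeas_E' : MeasurableSet E' :=
    hmeas_E.diff (Finset.measurableSet_biUnion _ fun k _ => hmeas_slab k)
  have hsection : ∀ a : Fin d → ℝ, volume {t : ℝ | t ∈ Set.Icc (1 : ℝ) 2 ∧ t • a ∈ E'} ≤
      ENNReal.ofReal (2 ^ (r + 1) * (8192 * 4 ^ (r + 1) + 1) * τ * T ^ 2) := by
    intro a
    rcases Set.eq_empty_or_nonempty {t : ℝ | t ∈ Set.Icc (1 : ℝ) 2 ∧ t • a ∈ E'} with
      he | ⟨t₀, ht₀, ⟨hbox₀, -⟩, hnot⟩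
    · rw [he]; simp
    have ha : ∀ l, 1 / 2 ≤ a l ∧ a l ≤ 4 := by
      intro l
      have h1 := hbox₀ l trivial
      simp only [Pi.smul_apply, smul_eq_mul] at h1
      have ha0 : 0 < a l := by
        by_contra hcon
        nlinarith [h1.1, ht₀.1]
      exact ⟨by nlinarith [h1.1, ht₀.2], by nlinarith [h1.2, ht₀.1]⟩
    have hx0 : ∀ j : Idx d, 0 ≤ anormSq d a j := fun j =>
      Finset.sum_nonneg fun l _ => mul_nonneg (by linarith [(ha l).1]) (sq_nonneg _)
    have hxJ : ∀ j : Idx d, 1 + anormSq d a j ^ 2 ≤ 16 * jap d j ^ 4 := by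
      intro j
      have h1 : anormSq d a j ≤ 4 * jnormSq d j := by
        rw [anormSq, jnormSq, Finset.mul_sum]
        exact Finset.sum_le_sum fun l _ => mul_le_mul_of_nonneg_right (ha l).2 (sq_nonneg _)
      have h2 : jap d j ^ 4 = (1 + jnormSq d j) ^ 2 := by rw [← jap_sq, ← pow_mul]
      rw [h2]
      nlinarith [hx0 j]
    have hgap : ∀ k ∈ B, τ / 4 ≤ |anormSq d a (jt k) ^ 2 - anormSq d a (jt k₀) ^ 2| := by
      intro k hk
      have h1 : τ ≤ |∑ l, (t₀ • a) l * v k l| := by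
        by_contra hcon
        exact hnot (Set.mem_biUnion hk ⟨hbox₀, not_le.1 hcon⟩)
      have h2 : ∑ l, (t₀ • a) l * v k l = t₀ * (anormSq d a (jt k) - anormSq d a (jt k₀)) := by
        rw [anormSq, anormSq, ← Finset.sum_sub_distrib, Finset.mul_sum]
        refine Finset.sum_congr rfl fun l _ => ?_
        simp only [Pi.smul_apply, smul_eq_mul, hv]
        ring
      rw [h2, abs_mul, abs_of_pos (by linarith [ht₀.1])] at h1
      have h3 : τ / 2 ≤ |anormSq d a (jt k) - anormSq d a (jt k₀)| := by
        nlinarith [ht₀.2, abs_nonneg (anormSq d a (jt k) - anormSq d a (jt k₀))]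
      have h4 : 1 / 2 ≤ anormSq d a (jt k) + anormSq d a (jt k₀) := by
        obtain ⟨l, hl⟩ := hdiff k hk
        have h5 : (1 : ℝ) ≤ (jt k l : ℝ) ^ 2 + (jt k₀ l : ℝ) ^ 2 := by
          have : jt k l ≠ 0 ∨ jt k₀ l ≠ 0 := by
            by_contra! hcon
            exact hl (by rw [hcon.1, hcon.2])
          have : 1 ≤ (jt k l) ^ 2 + (jt k₀ l) ^ 2 := by
            rcases this with h | h
            · nlinarith [sq_nonneg (jt k₀ l), pow_pos (abs_pos.2 h) 2, sq_abs (jt k l)]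
            · nlinarith [sq_nonneg (jt k l), pow_pos (abs_pos.2 h) 2, sq_abs (jt k₀ l)]
          exact_mod_cast this
        have h6 : ∀ j : Idx d, a l * (j l : ℝ) ^ 2 ≤ anormSq d a j := fun j =>
          Finset.single_le_sum (f := fun l => a l * (j l : ℝ) ^ 2)
            (fun l _ => mul_nonneg (by linarith [(ha l).1]) (sq_nonneg _)) (Finset.mem_univ l)
        nlinarith [h6 (jt k), h6 (jt k₀), (ha l).1]
      rw [sq_sub_sq, abs_mul, abs_of_nonneg (by linarith [hx0 (jt k), hx0 (jt k₀)])]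
      nlinarith
    refine le_trans (measure_mono ?_) (volume_sublevel_section_le hBA
      (fun k => anormSq d a (jt k)) (fun k => (σ k : ℝ)) (fun k => jap d (jt k))
      (anormSq d a (jt k₀)) (jap d (jt k₀)) (∑ i, a i * κ i) T τ ?_ ?_
      (fun k => one_le_jap _ _) (one_le_jap _ _) (fun k _ => hxJ _) (hxJ _) ?_ hτ hτ1 hgap
      hBcard (m := r ^ 2) (by nlinarith))
    · rintro t ⟨ht, ⟨-, hlt⟩, -⟩
      refine ⟨ht, ?_⟩
      simp only [omg, anormSq_smul] at hlt
      convert hlt using 4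
      rw [Finset.sum_mul]
      exact Finset.sum_congr rfl fun i _ => by simp only [Pi.smul_apply, smul_eq_mul]; ring
    · intro k hk
      rw [hAB] at hk
      exact anormSq_congr a (Finset.mem_filter.1 hk).2
    · rw [hAB]
      exact_mod_cast Int.one_le_abs hσ
    · have hsub : insert k₀ B ⊆ A := Finset.insert_subset hk₀ hBA
      rw [hT, tailProd_eq, ← hA, ← Finset.prod_insert (f := fun k => jap d (jt k)) hk₀B,
        ← Finset.prod_sdiff hsub]
      exact le_mul_of_one_le_left (zero_le_one.trans (one_le_prod_jap _ _)) (one_le_prod_jap _ _)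
  have hE'_le := volume_le_of_dilations hmeas_E' (fun a ha => ha.1.1) (by positivity) hsection
  have hcover : E ⊆ E' ∪ ⋃ k ∈ B, slab k := by
    intro a ha
    by_cases h : a ∈ ⋃ k ∈ B, slab k
    · exact Or.inr h
    · exact Or.inl ⟨ha, h⟩
  calc volume E ≤ volume E' + ∑ k ∈ B, volume (slab k) :=
        (measure_mono hcover).trans ((measure_union_le _ _).trans
          (add_le_add_right (measure_biUnion_finset_le _ _) _))
    _ ≤ ENNReal.ofReal (8 ^ d * (2 ^ (r + 1) * (8192 * 4 ^ (r + 1) + 1) * τ * T ^ 2)) +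
        ∑ _k ∈ B, ENNReal.ofReal (4 ^ d * (2 * τ)) := by
        gcongr with k hk
        exact hslab_le k hk
    _ = ENNReal.ofReal (8 ^ d * (2 ^ (r + 1) * (8192 * 4 ^ (r + 1) + 1) * τ * T ^ 2) +
        B.card * (4 ^ d * (2 * τ))) := by
        rw [Finset.sum_const, nsmul_eq_mul, ENNReal.ofReal_add (by positivity) (by positivity),
          ENNReal.ofReal_mul (p := (B.card : ℝ)) (by positivity), ENNReal.ofReal_natCast]
    _ ≤ _ := by
        refine ENNReal.ofReal_le_ofReal ?_
        have h1 : (B.card : ℝ) ≤ r := by exact_mod_cast (by omega : B.card ≤ r)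
        have h2 : 4 ^ d * (2 * τ) ≤ 4 ^ d * (2 * τ) * T ^ 2 :=
          le_mul_of_one_le_right (by positivity) (one_le_pow₀ hT1)
        have h3 : (B.card : ℝ) * (4 ^ d * (2 * τ)) ≤ r * (4 ^ d * (2 * τ) * T ^ 2) := by gcongr
        linarith

lemma sum_eq_add_add_sum_tail {M : Type*} [AddCommMonoid M] {r : ℕ} (hr : 3 ≤ r) (F : Fin r → M) :
    ∑ k, F k = F ⟨0, by omega⟩ + F ⟨1, by omega⟩ + ∑ k ∈ tail r, F k := by
  rw [← Finset.sum_filter_not_add_sum_filter Finset.univ (fun k : Fin r => 2 ≤ (k : ℕ)) F]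
  congr 1
  have : (Finset.univ.filter fun k : Fin r => ¬ 2 ≤ (k : ℕ)) = {⟨0, by omega⟩, ⟨1, by omega⟩} := by
    ext k
    simp only [Finset.mem_filter, Finset.mem_univ, true_and, Finset.mem_insert,
      Finset.mem_singleton, Fin.ext_iff]
    omega
  rw [this, Finset.sum_pair (by simp [Fin.ext_iff])]

lemma Jfam_of_mem_tail {d r : ℕ} (hr : 3 ≤ r) (σ : Fin r → ℤ) (jt : Fin r → Idx d) (j1 : Idx d)
    {k : Fin r} (hk : k ∈ tail r) : Jfam d r hr σ jt j1 k = jt k := by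
  rw [mem_tail] at hk
  simp [Jfam, show (k : ℕ) ≠ 0 by omega, show (k : ℕ) ≠ 1 by omega]

/-- If `|j₁|` and `|j₂|` agree componentwise and every class of the tail has vanishing total sign,
then `(σ, j)` is resonant. -/
lemma isResonant_of_class_sum_eq_zero {d r : ℕ} (hr : 3 ≤ r) (σ : Fin r → ℤ)
    (hσ : ∀ i, σ i = 1 ∨ σ i = -1) (hσ01 : σ ⟨0, by omega⟩ = -σ ⟨1, by omega⟩)
    (jt : Fin r → Idx d) (j1 : Idx d) (h12 : ∀ l, |j1 l| = |j2of d r hr σ jt j1 l|)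
    (htail : ∀ k₀ ∈ tail r, ∑ k ∈ tail r with ∀ l, |jt k l| = |jt k₀ l|, σ k = 0) :
    IsResonant σ (Jfam d r hr σ jt j1) := by
  set J := Jfam d r hr σ jt j1 with hJ
  set f : Fin r → Fin d → ℤ := fun k l => |J k l| with hf
  have hf_tail : ∀ k ∈ tail r, ∀ l, f k l = |jt k l| := fun k hk l => by
    rw [hf, hJ]
    simp only [Jfam_of_mem_tail hr σ jt j1 hk]
  have hf01 : f ⟨0, by omega⟩ = f ⟨1, by omega⟩ := by
    funext l
    simpa [hf, hJ, Jfam] using h12 l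
  have hclass : ∀ b, ∑ i with f i = b, σ i = 0 := by
    intro b
    rw [Finset.sum_filter, sum_eq_add_add_sum_tail hr, hf01, hσ01, ← Finset.sum_filter]
    have h1 : ∑ k ∈ tail r with f k = b, σ k = 0 := by
      by_cases hb : ∃ k₀ ∈ tail r, f k₀ = b
      · obtain ⟨k₀, hk₀, rfl⟩ := hb
        rw [← htail k₀ hk₀]
        refine Finset.sum_congr (Finset.filter_congr fun k hk => ?_) fun _ _ => rfl
        simp only [funext_iff, hf_tail k hk, hf_tail k₀ hk₀]
      · rw [Finset.filter_false_of_mem fun k hk hkb => hb ⟨k, hk, hkb⟩, Finset.sum_empty]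
    rw [h1]
    split_ifs <;> simp
  obtain ⟨ρ, hρρ, hρ⟩ := exists_involution_of_sum_eq_zero σ hσ f hclass
  refine ⟨?_, ρ, hρρ, fun i hi => ?_, fun i => ⟨fun l => congrFun (hρ i).1 l, (hρ i).2⟩⟩
  · have h0 : ∑ i, σ i = 0 := by
      have h1 : ∑ i, σ (ρ i) = ∑ i, σ i := Equiv.sum_comp ρ σ
      have h2 : ∑ i, σ (ρ i) = -∑ i, σ i := by
        rw [← Finset.sum_neg_distrib]
        exact Finset.sum_congr rfl fun i _ => (hρ i).2
      omega
    have h3 : ((∑ i, σ i : ℤ) : ZMod 2) = (r : ZMod 2) := by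
      push_cast
      rw [Finset.sum_congr rfl (g := fun _ => (1 : ZMod 2))]
      · simp
      · intro i _
        rcases hσ i with h | h <;> rw [h] <;> decide
    rw [h0] at h3
    exact (ZMod.natCast_eq_zero_iff_even).1 (by simpa using h3.symm)
  · have h1 := (hρ i).2
    rw [hi] at h1
    rcases hσ i with h | h <;> omega

/-- When every class of the tail has vanishing total sign, the tail contributes nothing. -/
lemma sum_tail_omg_eq_zero {d r : ℕ} (σ : Fin r → ℤ) (jt : Fin r → Idx d) (a : Fin d → ℝ)
    (htail : ∀ k₀ ∈ tail r, ∑ k ∈ tail r with ∀ l, |jt k l| = |jt k₀ l|, σ k = 0) :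
    ∑ k ∈ tail r, (σ k : ℝ) * omg d a (jt k) = 0 := by
  set f : Fin r → Fin d → ℤ := fun k l => |jt k l| with hf
  rw [← Finset.sum_fiberwise_of_maps_to (t := (tail r).image f) (g := f)
    fun k hk => Finset.mem_image_of_mem f hk]
  refine Finset.sum_eq_zero fun b hb => ?_
  obtain ⟨k₀, hk₀, rfl⟩ := Finset.mem_image.1 hb
  have h1 : ∀ k, f k = f k₀ ↔ ∀ l, |jt k l| = |jt k₀ l| := fun k => funext_iff
  simp only [h1]
  rw [Finset.sum_congr rfl (g := fun k => (σ k : ℝ) * omg d a (jt k₀)) fun k hk => by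
    rw [omg_congr a (Finset.mem_filter.1 hk).2], ← Finset.sum_mul, ← Int.cast_sum, htail k₀ hk₀]
  simp

/-- The coefficients `σ₁ (j₁ᵢ² - j₂ᵢ²)` of the linear part of `g`. -/
def linCoeff (d r : ℕ) (hr : 3 ≤ r) (σ : Fin r → ℤ) (jt : Fin r → Idx d) (j1 : Idx d) : Idx d :=
  fun i => σ ⟨0, by omega⟩ * (j1 i ^ 2 - j2of d r hr σ jt j1 i ^ 2)

lemma linCoeff_of_jge3_eq_zero {d r : ℕ} (hr : 3 ≤ r) (σ : Fin r → ℤ) (jt : Fin r → Idx d)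
    (j1 : Idx d) {i : Fin d} (hi : jge3 d r σ jt i = 0) : linCoeff d r hr σ jt j1 i = 0 := by
  simp [linCoeff, j2of, hi]

lemma exists_linCoeff_ne_zero {d r : ℕ} (hr : 3 ≤ r) (σ : Fin r → ℤ)
    (hσ : ∀ i, σ i = 1 ∨ σ i = -1) (hσ01 : σ ⟨0, by omega⟩ = -σ ⟨1, by omega⟩)
    (jt : Fin r → Idx d) (j1 : Idx d) (hnr : ¬ IsResonant σ (Jfam d r hr σ jt j1))
    (htail : ∀ k₀ ∈ tail r, ∑ k ∈ tail r with ∀ l, |jt k l| = |jt k₀ l|, σ k = 0) :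
    ∃ i, linCoeff d r hr σ jt j1 i ≠ 0 := by
  by_contra! hcon
  refine hnr (isResonant_of_class_sum_eq_zero hr σ hσ hσ01 jt j1 (fun l => ?_) htail)
  rcases mul_eq_zero.1 (hcon l) with h | h
  · rcases hσ ⟨0, by omega⟩ with h' | h' <;> omega
  · exact sq_eq_sq_iff_abs_eq_abs _ _ |>.1 (sub_eq_zero.1 h)

lemma abs_lt_of_memS {d r : ℕ} {hr : 3 ≤ r} {σ : Fin r → ℤ} {jt : Fin r → Idx d} {j1 : Idx d}
    (h : memS d r hr σ jt j1) {i : Fin d} (hi : jge3 d r σ jt i ≠ 0) :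
    |j1 i| < 2 * (1 + ∑ k ∈ tail r, (jt k i) ^ 2) := by
  have h1 := not_le.1 (h.1 i hi)
  rwa [← Finset.sum_filter] at h1

/-- The coordinates in which `j₁` and `j₂` agree carry most of the mass of `j₁`. -/
lemma le_sum_sq_of_memR {d r : ℕ} {hr : 3 ≤ r} {σ : Fin r → ℤ} {jt : Fin r → Idx d} {γ : ℝ}
    (hγ : 0 < γ) (hγd : γ * (8 * (d + 1)) ≤ 1) {j1 : Idx d} (h : memR d r hr σ jt γ j1) :
    γ⁻¹ / 2 ≤ ∑ i with jge3 d r σ jt i = 0, (j1 i : ℝ) ^ 2 := by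
  set T := tailProd d r jt with hT
  have hT1 : 1 ≤ T := one_le_tailProd d r jt
  have hinv : 8 * ((d : ℝ) + 1) ≤ γ⁻¹ := by
    rw [le_inv_comm₀ (by positivity) hγ, ← one_div, le_div_iff₀ (by positivity)]
    exact hγd
  have h1 : γ⁻¹ * (T ^ (2 * d * r ^ 2)) ^ 2 ≤ jnormSq d j1 := by
    have h2 : 0 ≤ jnormSq d j1 := Finset.sum_nonneg fun _ _ => sq_nonneg _
    have h3 := pow_le_pow_left₀ (by positivity) h.2 2
    rw [enorm, Real.sq_sqrt h2, mul_pow, ← Real.rpow_natCast (γ ^ (-(1 : ℝ) / 2)),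
      ← Real.rpow_mul hγ.le] at h3
    norm_num [Real.rpow_neg_one] at h3
    exact h3
  have hd : d ≠ 0 := by
    rintro rfl
    have : 0 < γ⁻¹ * (T ^ (2 * 0 * r ^ 2)) ^ 2 := by positivity
    simp [jnormSq] at h1
    linarith
  have hT4 : T ^ 4 ≤ (T ^ (2 * d * r ^ 2)) ^ 2 := by
    rw [← pow_mul]
    refine pow_le_pow_right₀ hT1 ?_
    have : 1 ≤ d * r ^ 2 := Nat.one_le_iff_ne_zero.2 (by positivity)
    nlinarith
  have hbad : ∑ i with ¬ jge3 d r σ jt i = 0, (j1 i : ℝ) ^ 2 ≤ d * (4 * T ^ 4) := by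
    calc _ ≤ ∑ i : Fin d with ¬ jge3 d r σ jt i = 0, 4 * T ^ 4 := by
          refine Finset.sum_le_sum fun i hi => ?_
          have h2 : |(j1 i : ℝ)| ≤ 2 * (1 + ∑ k ∈ tail r, (jt k i : ℝ) ^ 2) := by
            exact_mod_cast (abs_lt_of_memS h.1 (Finset.mem_filter.1 hi).2).le
          have h3 : |(j1 i : ℝ)| ≤ 2 * T ^ 2 := by
            linarith [one_add_sum_sq_le_tailProd_sq jt i]
          rw [← sq_abs]
          calc |(j1 i : ℝ)| ^ 2 ≤ (2 * T ^ 2) ^ 2 := by gcongr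
            _ = 4 * T ^ 4 := by ring
      _ ≤ d * (4 * T ^ 4) := by
          rw [Finset.sum_const, nsmul_eq_mul]
          gcongr
          simpa using Finset.card_filter_le (Finset.univ : Finset (Fin d)) _
  have hsplit := Finset.sum_filter_add_sum_filter_not Finset.univ
    (fun i => jge3 d r σ jt i = 0) (fun i => (j1 i : ℝ) ^ 2)
  rw [← jnormSq] at hsplit
  have hT41 : 1 ≤ T ^ 4 := one_le_pow₀ hT1
  have h5 : γ⁻¹ * T ^ 4 ≤ jnormSq d j1 := le_trans (by gcongr) h1
  have h6 : 8 * ((d : ℝ) + 1) * T ^ 4 ≤ γ⁻¹ * T ^ 4 := by gcongr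
  have h7 : γ⁻¹ ≤ γ⁻¹ * T ^ 4 := le_mul_of_one_le_right (by positivity) hT41
  linarith

lemma abs_omg_sub_anormSq_le {d : ℕ} {a : Fin d → ℝ} {j : Idx d} {γ : ℝ} (hγ : 0 < γ)
    (h : γ⁻¹ / 2 ≤ anormSq d a j) : |omg d a j - anormSq d a j| ≤ γ := by
  have h0 : 0 < γ⁻¹ := by positivity
  have h1 : anormSq d a j ≤ omg d a j := Real.le_sqrt_of_sq_le (by linarith)
  have h2 : omg d a j ≤ anormSq d a j + γ := by
    refine Real.sqrt_le_iff.2 ⟨by linarith, ?_⟩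
    have : γ⁻¹ * γ = 1 := inv_mul_cancel₀ hγ.ne'
    nlinarith
  rw [abs_of_nonneg (by linarith)]
  linarith

/-- On `R_γ`, the function `g` is close to its limit as `|j₁| → ∞`. -/
lemma abs_limit_lt_of_abs_gfun_lt {d r : ℕ} {hr : 3 ≤ r} {σ : Fin r → ℤ}
    (hσ : ∀ i, σ i = 1 ∨ σ i = -1) (hσ01 : σ ⟨0, by omega⟩ = -σ ⟨1, by omega⟩)
    {jt : Fin r → Idx d} {γ : ℝ} (hγ : 0 < γ) (hγd : γ * (8 * (d + 1)) ≤ 1) {j1 : Idx d}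
    (h : memR d r hr σ jt γ j1) {a : Fin d → ℝ} (ha : a ∈ box d)
    (hg : |gfun d r hr σ jt j1 a| < γ) :
    |∑ i, a i * (linCoeff d r hr σ jt j1 i : ℝ) +
      ∑ k ∈ tail r, (σ k : ℝ) * omg d a (jt k)| < 3 * γ := by
  have hmass := le_sum_sq_of_memR hγ hγd h
  set j2 := j2of d r hr σ jt j1 with hj2
  have hX : ∀ j : Idx d, (∀ i, jge3 d r σ jt i = 0 → j i = j1 i) →
      γ⁻¹ / 2 ≤ anormSq d a j := by
    intro j hj
    refine hmass.trans ?_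
    calc ∑ i with jge3 d r σ jt i = 0, (j1 i : ℝ) ^ 2
        ≤ ∑ i with jge3 d r σ jt i = 0, a i * (j i : ℝ) ^ 2 := by
          refine Finset.sum_le_sum fun i hi => ?_
          rw [hj i (Finset.mem_filter.1 hi).2]
          exact le_mul_of_one_le_left (sq_nonneg _) (ha i trivial).1.le
      _ ≤ anormSq d a j :=
          Finset.sum_le_sum_of_subset_of_nonneg (Finset.filter_subset _ _) fun i _ _ =>
            mul_nonneg (zero_le_one.trans (ha i trivial).1.le) (sq_nonneg _)
  have h1 := abs_omg_sub_anormSq_le hγ (hX j1 fun _ _ => rfl)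
  have h2 := abs_omg_sub_anormSq_le hγ (hX j2 fun i hi => by simp [hj2, j2of, hi])
  have hlin : ∑ i, a i * (linCoeff d r hr σ jt j1 i : ℝ) =
      (σ ⟨0, by omega⟩ : ℝ) * (anormSq d a j1 - anormSq d a j2) := by
    rw [anormSq, anormSq, ← Finset.sum_sub_distrib, Finset.mul_sum]
    refine Finset.sum_congr rfl fun i _ => ?_
    simp only [linCoeff, ← hj2]
    push_cast
    ring
  have hgeq : gfun d r hr σ jt j1 a = (σ ⟨0, by omega⟩ : ℝ) * (omg d a j1 - omg d a j2) +
      ∑ k ∈ tail r, (σ k : ℝ) * omg d a (jt k) := by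
    rw [gfun, sum_eq_add_add_sum_tail hr]
    congr 1
    · have h3 : (σ ⟨1, by omega⟩ : ℝ) = -(σ ⟨0, by omega⟩ : ℝ) := by rw [hσ01]; simp
      rw [h3]
      simp only [Jfam, if_true, one_ne_zero, if_false, ← hj2]
      ring
    · exact Finset.sum_congr rfl fun k hk => by rw [Jfam_of_mem_tail hr σ jt j1 hk]
  rw [hgeq] at hg
  rw [hlin]
  rw [abs_lt] at hg ⊢
  rw [abs_le] at h1 h2
  rcases hσ ⟨0, by omega⟩ with h4 | h4 <;> rw [h4] at hg ⊢ <;> push_cast at hg ⊢ <;>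
    constructor <;> linarith [h1.1, h1.2, h2.1, h2.2, hg.1, hg.2]

/-- Lemma 2.8, `lem_deg_large`: for all `γ > 0`, the measure of the
set of `a ∈ (1,4)^d` for which there exists `j₁ ∈ R_γ` with `|g_{j₁}(a)| < γ` is
`≲_{r,d} γ^{1/r²} (⟨j₃⟩⋯⟨j_r⟩)^{2d}`. -/
theorem measure_exceptional_R_le (d r : ℕ) (hr : 3 ≤ r) :
    ∃ C : ℝ, 0 < C ∧
      ∀ (σ : Fin r → ℤ),
        (∀ i, σ i = 1 ∨ σ i = -1) →
        σ ⟨0, by omega⟩ = - σ ⟨1, by omega⟩ →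
        ∀ (jt : Fin r → Idx d) (γ : ℝ), 0 < γ →
          volume {a : Fin d → ℝ | a ∈ box d ∧
              ∃ j1 : Idx d, memR d r hr σ jt γ j1 ∧ |gfun d r hr σ jt j1 a| < γ}
            ≤ ENNReal.ofReal
                (C * γ ^ ((1 : ℝ) / (r : ℝ) ^ 2) * tailProd d r jt ^ (2 * d : ℕ)) := by
  have hr0 : r ≠ 0 := by omega
  set C₁ : ℝ := (8 ^ d * (2 ^ (r + 1) * (8192 * 4 ^ (r + 1) + 1)) + r * (4 ^ d * 2)) + 6 * 4 ^ d
    with hC₁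
  refine ⟨5 ^ d * C₁ + 4 ^ d * (8 * (d + 1)), by positivity, ?_⟩
  intro σ hσ hσ01 jt γ hγ
  set T := tailProd d r jt with hT
  have hT1 : 1 ≤ T := one_le_tailProd d r jt
  set τ := γ ^ ((1 : ℝ) / (r : ℝ) ^ 2) with hτdef
  have hτ : 0 < τ := Real.rpow_pos_of_pos hγ _
  have hτγ : τ ^ (r ^ 2) = γ := by
    rw [hτdef, ← Real.rpow_natCast, ← Real.rpow_mul hγ.le]
    push_cast
    rw [one_div, inv_mul_cancel₀ (by positivity), Real.rpow_one]
  rcases lt_or_ge 1 (γ * (8 * (d + 1))) with hbig | hγd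
  · refine (measure_mono fun a ha => ha.1).trans ((volume_box_le d).trans
      (ENNReal.ofReal_le_ofReal ?_))
    have h1 : 1 ≤ τ * (8 * (d + 1)) := by
      rcases le_or_gt 1 τ with h | h
      · nlinarith [(Nat.cast_nonneg d : (0 : ℝ) ≤ d)]
      · have : γ ≤ τ := by
          rw [← hτγ]
          exact pow_le_of_le_one hτ.le h.le (by positivity)
        refine hbig.le.trans ?_
        gcongr
    have h2 : 1 ≤ T ^ (2 * d) := one_le_pow₀ hT1
    have h3 : 0 ≤ 5 ^ d * C₁ * τ * T ^ (2 * d) := by positivity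
    calc (4 : ℝ) ^ d ≤ 4 ^ d * (τ * (8 * (d + 1)) * T ^ (2 * d)) :=
          le_mul_of_one_le_right (by positivity) (one_le_mul_of_one_le_of_one_le h1 h2)
      _ ≤ _ := by linarith
  have hγ1 : γ ≤ 1 := by nlinarith [(Nat.cast_nonneg d : (0 : ℝ) ≤ d)]
  have hτ1 : τ ≤ 1 := Real.rpow_le_one hγ.le hγ1 (by positivity)
  by_cases hR : ∃ j1, memR d r hr σ jt γ j1
  swap
  · have : {a : Fin d → ℝ | a ∈ box d ∧
        ∃ j1 : Idx d, memR d r hr σ jt γ j1 ∧ |gfun d r hr σ jt j1 a| < γ} = ∅ :=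
      Set.eq_empty_of_forall_notMem fun a ha => hR ⟨_, ha.2.choose_spec.1⟩
    rw [this]
    simp
  obtain ⟨i₁, hi₁⟩ : ∃ i, jge3 d r σ jt i = 0 := by
    obtain ⟨j1, hj1⟩ := hR
    have h1 := le_sum_sq_of_memR hγ hγd hj1
    have h2 : 0 < γ⁻¹ := by positivity
    obtain ⟨i, hi, -⟩ := Finset.exists_ne_zero_of_sum_ne_zero
      (by linarith : 0 < ∑ i with jge3 d r σ jt i = 0, (j1 i : ℝ) ^ 2).ne'
    exact ⟨i, (Finset.mem_filter.1 hi).2⟩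
  set M : Idx d := fun i => 2 * (1 + ∑ k ∈ tail r, (jt k i) ^ 2) with hM
  set V : Finset (Idx d) := Fintype.piFinset fun i =>
    if jge3 d r σ jt i = 0 then {0} else Finset.Icc (-M i) (M i) with hV
  set sub : Idx d → Set (Fin d → ℝ) := fun v => {a | a ∈ box d ∧
    |∑ i, a i * (linCoeff d r hr σ jt v i : ℝ) +
      ∑ k ∈ tail r, (σ k : ℝ) * omg d a (jt k)| < 3 * τ ^ (r ^ 2)} with hsub
  set V' := V.filter fun v => (∀ k₀ ∈ tail r,
    ∑ k ∈ tail r with ∀ l, |jt k l| = |jt k₀ l|, σ k = 0) → ∃ i, linCoeff d r hr σ jt v i ≠ 0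
    with hV'
  have hcover : {a : Fin d → ℝ | a ∈ box d ∧
      ∃ j1 : Idx d, memR d r hr σ jt γ j1 ∧ |gfun d r hr σ jt j1 a| < γ} ⊆
      ⋃ v ∈ V', sub v := by
    rintro a ⟨ha, j1, hj1, hg⟩
    set v : Idx d := fun i => if jge3 d r σ jt i = 0 then 0 else j1 i with hv
    have hlin : linCoeff d r hr σ jt v = linCoeff d r hr σ jt j1 := by
      funext i
      by_cases hi : jge3 d r σ jt i = 0
      · rw [linCoeff_of_jge3_eq_zero hr σ jt v hi, linCoeff_of_jge3_eq_zero hr σ jt j1 hi]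
      · simp [linCoeff, j2of, hv, hi]
    refine Set.mem_biUnion (x := v) (Finset.mem_filter.2 ⟨?_, fun htail => ?_⟩) ⟨ha, ?_⟩
    · rw [hV, Fintype.mem_piFinset]
      intro i
      by_cases hi : jge3 d r σ jt i = 0
      · simp [hv, hi]
      · simp only [hv, hi, if_false, Finset.mem_Icc]
        exact abs_le.1 (abs_lt_of_memS hj1.1 hi).le
    · rw [hlin]
      exact exists_linCoeff_ne_zero hr σ hσ hσ01 jt j1 hj1.1.2 htail
    · rw [hlin, hτγ]
      exact abs_limit_lt_of_abs_gfun_lt hσ hσ01 hγ hγd hj1 ha hg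
  have hsub_le : ∀ v ∈ V', volume (sub v) ≤ ENNReal.ofReal (C₁ * τ * T ^ 2) := by
    intro v hv
    by_cases htail : ∀ k₀ ∈ tail r, ∑ k ∈ tail r with ∀ l, |jt k l| = |jt k₀ l|, σ k = 0
    · obtain ⟨i, hi⟩ := (Finset.mem_filter.1 hv).2 htail
      have h1 := volume_slab_le (fun l => (linCoeff d r hr σ jt v l : ℝ)) i
        (by exact_mod_cast Int.one_le_abs hi) (3 * τ ^ (r ^ 2)) (by positivity)
      simp only [hsub, sum_tail_omg_eq_zero σ jt _ htail, add_zero]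
      refine h1.trans (ENNReal.ofReal_le_ofReal ?_)
      have h2 : τ ^ (r ^ 2) ≤ τ := pow_le_of_le_one hτ.le hτ1 (by positivity)
      have h3 : τ ≤ τ * T ^ 2 := le_mul_of_one_le_right hτ.le (one_le_pow₀ hT1)
      calc 4 ^ d * (2 * (3 * τ ^ (r ^ 2))) = 6 * 4 ^ d * τ ^ (r ^ 2) := by ring
        _ ≤ 6 * 4 ^ d * (τ * T ^ 2) := by gcongr; exact h2.trans h3
        _ ≤ C₁ * (τ * T ^ 2) := by
            gcongr
            rw [hC₁]
            exact le_add_of_nonneg_left (by positivity)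
        _ = C₁ * τ * T ^ 2 := by ring
    · push Not at htail
      obtain ⟨k₀, hk₀, hne⟩ := htail
      refine (volume_sublevel_le_of_class_ne_zero hr σ jt
        (fun i => (linCoeff d r hr σ jt v i : ℝ)) k₀ hk₀ hne hτ hτ1).trans
        (ENNReal.ofReal_le_ofReal ?_)
      gcongr
      rw [hC₁]
      exact le_add_of_nonneg_right (by positivity)
  have hcard : (V'.card : ℝ) * T ^ 2 ≤ 5 ^ d * T ^ (2 * d) := by
    set b : Fin d → ℝ := fun i => if jge3 d r σ jt i = 0 then 1 else 5 * T ^ 2 with hb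
    have hT2 : 1 ≤ T ^ 2 := one_le_pow₀ hT1
    have hb0 : ∀ i, 0 ≤ b i := fun i => by
      simp only [hb]
      split_ifs <;> positivity
    have hb5 : ∀ i, b i ≤ 5 * T ^ 2 := fun i => by
      simp only [hb]
      split_ifs <;> linarith
    have h1 : (V'.card : ℝ) ≤ ∏ i, b i := by
      have h2 : (V'.card : ℝ) ≤ V.card := by exact_mod_cast Finset.card_filter_le _ _
      refine h2.trans ?_
      rw [hV, Fintype.card_piFinset]
      push_cast
      refine Finset.prod_le_prod (fun _ _ => by positivity) fun i _ => ?_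
      by_cases hi : jge3 d r σ jt i = 0
      · simp [hb, hi]
      · simp only [hb, hi, if_false, Int.card_Icc]
        have hM0 : 0 ≤ M i := by
          have : 0 ≤ ∑ k ∈ tail r, (jt k i) ^ 2 := Finset.sum_nonneg fun _ _ => sq_nonneg _
          simp only [hM]
          omega
        have hMT : (M i : ℝ) ≤ 2 * T ^ 2 := by
          have := one_add_sum_sq_le_tailProd_sq jt i
          simp only [hM]
          push_cast
          linarith
        have h3 : (((M i + 1 - -M i).toNat : ℤ) : ℝ) = 2 * M i + 1 := by
          rw [Int.toNat_of_nonneg (by omega)]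
          push_cast
          ring
        rw [Int.cast_natCast] at h3
        rw [h3]
        linarith
    calc (V'.card : ℝ) * T ^ 2 ≤ (∏ i, b i) * (5 * T ^ 2) :=
          mul_le_mul h1 (by linarith) (by positivity) (Finset.prod_nonneg fun i _ => hb0 i)
      _ = (∏ i ∈ Finset.univ.erase i₁, b i) * (5 * T ^ 2) := by
          rw [← Finset.mul_prod_erase _ _ (Finset.mem_univ i₁)]
          simp [hb, hi₁]
      _ ≤ (∏ _i ∈ Finset.univ.erase i₁, 5 * T ^ 2) * (5 * T ^ 2) := by
          gcongr with i
          exact hb5 i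
      _ = 5 ^ d * T ^ (2 * d) := by
          rw [Finset.prod_erase_mul _ (fun _ : Fin d => 5 * T ^ 2) (Finset.mem_univ i₁),
            Finset.prod_const, Finset.card_univ, Fintype.card_fin, mul_pow, ← pow_mul]
  calc _ ≤ ∑ v ∈ V', volume (sub v) :=
        (measure_mono hcover).trans (measure_biUnion_finset_le _ _)
    _ ≤ ∑ _v ∈ V', ENNReal.ofReal (C₁ * τ * T ^ 2) := Finset.sum_le_sum hsub_le
    _ = ENNReal.ofReal (V'.card * (C₁ * τ * T ^ 2)) := by
        rw [Finset.sum_const, nsmul_eq_mul, ENNReal.ofReal_mul (p := (V'.card : ℝ))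
          (by positivity), ENNReal.ofReal_natCast]
    _ ≤ _ := by
        refine ENNReal.ofReal_le_ofReal ?_
        calc (V'.card : ℝ) * (C₁ * τ * T ^ 2) = C₁ * τ * (V'.card * T ^ 2) := by ring
          _ ≤ C₁ * τ * (5 ^ d * T ^ (2 * d)) := by gcongr
          _ = 5 ^ d * C₁ * τ * T ^ (2 * d) := by ring
          _ ≤ (5 ^ d * C₁ + 4 ^ d * (8 * (d + 1))) * τ * T ^ (2 * d) := by
              gcongr
              exact le_add_of_nonneg_right (by positivity)

end BeamPaper
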